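/- arXiv:1908.08121 — 6 statements merged into one kernel-verified Lean document; each statement's English description precedes it below -/
import Mathlib

section
/- Let {T_k = (V_k,E_k) : k ∈ ℕ} be a sequence of finite rooted trees with |V_k| → ∞, let b ∈ [0,1), and for each k let ν_k be a b-Lipschitz 𝓗-valued Markov measure indexed by T_k, with Δ_k the ℓ² norm of the descendant generating function of T_k with parameter b. If Δ_k = o(|V_k|) then the sequence of metric probability spaces (𝓗^{V_k}, d, ν_k) is a Lévy family; if Δ_k = O(√|V_k|) then it is a normal Lévy family. -/
open MeasureTheory ProbabilityTheory Filter Topology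
open scoped ENNReal NNReal

/-- A rooted tree on vertex type `V`, encoded by its root and parent function:
every vertex reaches the root by iterating `parent`, and the root is a fixed
point of `parent`. -/
structure ParentTree (V : Type*) where
  root : V
  parent : V → V
  parent_root : parent root = root
  reaches_root : ∀ v : V, ∃ n : ℕ, parent^[n] v = root

namespace ParentTree

variable {V : Type*} (T : ParentTree V)

/-- The depth of a vertex: its graph distance to the root. -/
noncomputable def depth (v : V) : ℕ := sInf {n : ℕ | T.parent^[n] v = T.root}

lemma depth_spec (v : V) : T.parent^[T.depth v] v = T.root :=
  Nat.sInf_mem (T.reaches_root v)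

lemma depth_root : T.depth T.root = 0 :=
  Nat.eq_zero_of_le_zero (Nat.sInf_le (by simp))

lemma depth_parent_le (v : V) : T.depth (T.parent v) ≤ T.depth v := by
  have hspec := T.depth_spec v
  cases h : T.depth v with
  | zero =>
      rw [h] at hspec
      simp only [Function.iterate_zero, id_eq] at hspec
      subst hspec
      simp [T.parent_root, T.depth_root]
  | succ m =>
      rw [h, Function.iterate_succ_apply] at hspec
      exact (Nat.sInf_le hspec).trans (Nat.le_succ m)

/-- `Desc T r v` is the set of descendants of `v` exactly `r` generations below `v`. -/
def Desc (r : ℕ) (v : V) : Set V :=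
  {w : V | T.parent^[r] w = v ∧ T.depth w = T.depth v + r}

/-- The set of children of a vertex. -/
def children (v : V) : Set V := {w : V | w ≠ T.root ∧ T.parent w = v}

/-- The graph distance between two vertices of the tree. -/
noncomputable def tdist (v w : V) : ℕ :=
  sInf {k : ℕ | ∃ n m : ℕ, n + m = k ∧ T.parent^[n] v = T.parent^[m] w}

/-- The descendant generating function `δ(v) = ∑_r |D_r(v)| bʳ`. -/
noncomputable def dgf (b : ℝ) (v : V) : ℝ :=
  ∑' r : ℕ, (Nat.card (T.Desc r v) : ℝ) * b ^ r

/-- `Δ = ‖δ‖_{ℓ²(V)}` for a finite tree. -/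
noncomputable def Delta [Fintype V] (b : ℝ) : ℝ :=
  Real.sqrt (∑ v : V, T.dgf b v ^ 2)

/-- Upper growth rate `limsup_r |D_r(ρ)|^{1/r}`. -/
noncomputable def bargr : ℝ≥0∞ :=
  Filter.atTop.limsup fun r : ℕ => (Nat.card (T.Desc r T.root) : ℝ≥0∞) ^ (1 / (r : ℝ))

/-- Maximum local growth rate `limsup_r max_v |D_r(v)|^{1/r}`. -/
noncomputable def maxgr : ℝ≥0∞ :=
  Filter.atTop.limsup fun r : ℕ => ⨆ v : V, (Nat.card (T.Desc r v) : ℝ≥0∞) ^ (1 / (r : ℝ))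

/-- The parent map of the depth-`k` truncation. -/
noncomputable def truncParent (k : ℕ) (v : {v : V // T.depth v ≤ k}) :
    {v : V // T.depth v ≤ k} :=
  ⟨T.parent v.1, le_trans (T.depth_parent_le v.1) v.2⟩

lemma truncParent_iterate (k n : ℕ) (v : {v : V // T.depth v ≤ k}) :
    ((T.truncParent k)^[n] v).1 = T.parent^[n] v.1 := by
  induction n generalizing v with
  | zero => rfl
  | succ n ih =>
      rw [Function.iterate_succ_apply, Function.iterate_succ_apply]
      exact ih _

/-- The subtree induced by the vertices within distance `k` of the root. -/
noncomputable def trunc (k : ℕ) : ParentTree {v : V // T.depth v ≤ k} where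
  root := ⟨T.root, by simp [T.depth_root]⟩
  parent := T.truncParent k
  parent_root := Subtype.ext T.parent_root
  reaches_root := fun v => by
    obtain ⟨n, hn⟩ := T.reaches_root v.1
    exact ⟨n, Subtype.ext (by rw [truncParent_iterate, hn])⟩

end ParentTree
/-- The transportation cost between two measures relative to a cost function `c`:
the infimum over couplings `γ` of `∫ c dγ`. -/
noncomputable def transportCost {X : Type*} [MeasurableSpace X] (c : X → X → ℝ)
    (μ ν : MeasureTheory.Measure X) : ℝ :=
  sInf {r : ℝ | ∃ γ : MeasureTheory.Measure (X × X),
    γ.map Prod.fst = μ ∧ γ.map Prod.snd = ν ∧ r = ∫ q, c q.1 q.2 ∂γ}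

/-- The normalized Hamming distance on `V → H` induced by the metric of `H`. -/
noncomputable def nhdist {V H : Type*} [Fintype V] [PseudoMetricSpace H] (x y : V → H) : ℝ :=
  (Fintype.card V : ℝ)⁻¹ * ∑ v, dist (x v) (y v)

namespace ParentTree

open Classical in
/-- The broadcast (Markov) measure built up level by level: at step `k+1` all the
coordinates at depth `k+1` are sampled, conditionally independently, from the kernels
applied to the values at their parents. -/
noncomputable def levelMeasure {V : Type*} [Fintype V] (T : ParentTree V)
    {H : Type*} [MeasurableSpace H] (m : MeasureTheory.Measure H)
    (q : V → ProbabilityTheory.Kernel H H) : ℕ → MeasureTheory.Measure (V → H)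
  | 0 => m.map (fun h _ => h)
  | (k+1) => (T.levelMeasure m q k).bind fun x =>
      MeasureTheory.Measure.pi fun v =>
        if T.depth v = k + 1 then (q v) (x (T.parent v)) else MeasureTheory.Measure.dirac (x v)

/-- `ν` is a `b`-Lipschitz `H`-valued Markov measure indexed by `T`: it is the broadcast
model of some root distribution and some Markov kernels, each non-root kernel being
`b`-Lipschitz from `H` to the space of measures with the transportation metric. -/
def IsLipMarkov {V : Type*} [Fintype V] (T : ParentTree V)
    {H : Type*} [MeasurableSpace H] [PseudoMetricSpace H] (b : ℝ)
    (ν : MeasureTheory.Measure (V → H)) : Prop :=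
  ∃ (m : MeasureTheory.Measure H) (q : V → ProbabilityTheory.Kernel H H),
    MeasureTheory.IsProbabilityMeasure m ∧ (∀ v, ProbabilityTheory.IsMarkovKernel (q v)) ∧
    (∀ v, v ≠ T.root → ∀ x y : H, transportCost dist ((q v) x) ((q v) y) ≤ b * dist x y) ∧
    ν = T.levelMeasure m q (Fintype.card V)

end ParentTree

section Concentration

/-- `μ` has sub-Gaussian exponential moments for `g`, with variance proxy `c / 4`. -/
def HasGaussianMGF {X : Type*} [MeasurableSpace X] (μ : Measure X) (g : X → ℝ) (c : ℝ) : Prop :=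
  ∀ t : ℝ, ∫⁻ x, ENNReal.ofReal (Real.exp (t * g x)) ∂μ ≤
    ENNReal.ofReal (Real.exp (t * ∫ x, g x ∂μ + c * t ^ 2 / 8))

/-- `g` is Lipschitz for the weighted Hamming distance with weights `w`. -/
def WeightedLipschitz {V H : Type*} [Fintype V] [PseudoMetricSpace H] (w : V → ℝ)
    (g : (V → H) → ℝ) : Prop :=
  ∀ x y, |g x - g y| ≤ ∑ v, w v * dist (x v) (y v)

/-- The transportation distance between `μ` and `ν` is at most `r`. -/
def TransportLE {X : Type*} [MeasurableSpace X] [PseudoMetricSpace X] (μ ν : Measure X)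
    (r : ℝ) : Prop :=
  ∀ η > 0, ∃ γ : Measure (X × X), γ.map Prod.fst = μ ∧ γ.map Prod.snd = ν ∧
    ∫ z, dist z.1 z.2 ∂γ ≤ r + η

lemma TransportLE.of_transportCost_le {X : Type*} [MeasurableSpace X] [PseudoMetricSpace X]
    {μ ν : Measure X} [IsProbabilityMeasure μ] [IsProbabilityMeasure ν] {r : ℝ}
    (h : transportCost dist μ ν ≤ r) : TransportLE μ ν r := by
  intro η hη
  have hne : {r : ℝ | ∃ γ : Measure (X × X), γ.map Prod.fst = μ ∧ γ.map Prod.snd = ν ∧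
      r = ∫ q, dist q.1 q.2 ∂γ}.Nonempty :=
    ⟨_, μ.prod ν, by simp, by simp, rfl⟩
  obtain ⟨a, ⟨γ, h1, h2, rfl⟩, ha⟩ := exists_lt_of_csInf_lt hne
    (show sInf _ < r + η from lt_of_le_of_lt h (by linarith))
  exact ⟨γ, h1, h2, ha.le⟩

lemma transportLE_dirac {X : Type*} [MeasurableSpace X] [PseudoMetricSpace X]
    [OpensMeasurableSpace X] [SecondCountableTopology X] (x y : X) :
    TransportLE (Measure.dirac x) (Measure.dirac y) (dist x y) := by
  intro η hη
  refine ⟨Measure.dirac (x, y), Measure.map_dirac' measurable_fst _,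
    Measure.map_dirac' measurable_snd _, ?_⟩
  rw [integral_dirac']
  · simpa using hη.le
  · exact measurable_dist.stronglyMeasurable

lemma transportLE_self {X : Type*} [MeasurableSpace X] [PseudoMetricSpace X]
    [OpensMeasurableSpace X] [SecondCountableTopology X] (μ : Measure X) :
    TransportLE μ μ 0 := by
  intro η hη
  have hm : Measurable fun x : X => (x, x) := by fun_prop
  refine ⟨μ.map fun x => (x, x), ?_, ?_, ?_⟩
  · rw [Measure.map_map measurable_fst hm]; exact Measure.map_id
  · rw [Measure.map_map measurable_snd hm]; exact Measure.map_id
  · rw [integral_map hm.aemeasurable measurable_dist.stronglyMeasurable.aestronglyMeasurable]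
    simpa using hη.le

lemma HasGaussianMGF.measure_lt_le {X : Type*} [MeasurableSpace X] {μ : Measure X} {g : X → ℝ}
    {c : ℝ} (h : HasGaussianMGF μ g c) (hg : Measurable g) (h0 : ∫ x, g x ∂μ = 0) (hc : 0 < c)
    {a : ℝ} (ha : 0 < a) :
    μ {x | a < g x} ≤ ENNReal.ofReal (Real.exp (-2 * a ^ 2 / c)) := by
  set t : ℝ := 4 * a / c with ht
  have ht0 : 0 < t := by positivity
  have hmarkov : ENNReal.ofReal (Real.exp (t * a)) * μ {x | a < g x} ≤
      ENNReal.ofReal (Real.exp (c * t ^ 2 / 8)) := by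
    calc _ ≤ ENNReal.ofReal (Real.exp (t * a)) *
          μ {x | ENNReal.ofReal (Real.exp (t * a)) ≤ ENNReal.ofReal (Real.exp (t * g x))} := by
            gcongr with x
            intro hx
            gcongr
      _ ≤ ∫⁻ x, ENNReal.ofReal (Real.exp (t * g x)) ∂μ :=
            mul_meas_ge_le_lintegral (by fun_prop) _
      _ ≤ _ := by simpa [h0] using h t
  have hsplit : ENNReal.ofReal (Real.exp (c * t ^ 2 / 8)) =
      ENNReal.ofReal (Real.exp (t * a)) * ENNReal.ofReal (Real.exp (-2 * a ^ 2 / c)) := by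
    rw [← ENNReal.ofReal_mul (Real.exp_pos _).le, ← Real.exp_add]
    congr 2
    rw [ht]
    field_simp
    ring
  rw [hsplit] at hmarkov
  exact (ENNReal.mul_le_mul_iff_right (by simpa using Real.exp_pos _) (by simp)).1 hmarkov

lemma integral_measure_bind {X Y : Type*} [MeasurableSpace X] [MeasurableSpace Y] {μ : Measure X}
    [IsProbabilityMeasure μ] {κ : X → Measure Y} (hκ : Measurable κ) {g : Y → ℝ}
    (hg : Integrable g (μ.bind κ)) :
    ∫ y, g y ∂(μ.bind κ) = ∫ x, ∫ y, g y ∂(κ x) ∂μ := by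
  have h := Kernel.integral_comp (κ := Kernel.const Unit μ) (η := ⟨κ, hκ⟩) (a := ()) (f := g)
  rw [Kernel.comp_apply] at h
  exact h hg

lemma HasGaussianMGF.bind {X Y : Type*} [MeasurableSpace X] [MeasurableSpace Y] {μ : Measure X}
    [IsProbabilityMeasure μ] {κ : X → Measure Y} (hκ : Measurable κ) {g : Y → ℝ}
    (hg : Measurable g) (hgi : Integrable g (μ.bind κ)) {c₁ c₂ : ℝ}
    (h₁ : ∀ x, HasGaussianMGF (κ x) g c₁)
    (h₂ : HasGaussianMGF μ (fun x => ∫ y, g y ∂(κ x)) c₂) :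
    HasGaussianMGF (μ.bind κ) g (c₁ + c₂) := by
  intro t
  rw [Measure.lintegral_bind hκ.aemeasurable (by fun_prop), integral_measure_bind hκ hgi]
  calc _ ≤ ∫⁻ x, ENNReal.ofReal (Real.exp (c₁ * t ^ 2 / 8)) *
        ENNReal.ofReal (Real.exp (t * ∫ y, g y ∂(κ x))) ∂μ := by
          refine lintegral_mono fun x => (h₁ x t).trans_eq ?_
          rw [← ENNReal.ofReal_mul (Real.exp_pos _).le, ← Real.exp_add, add_comm]
    _ = ENNReal.ofReal (Real.exp (c₁ * t ^ 2 / 8)) *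
        ∫⁻ x, ENNReal.ofReal (Real.exp (t * ∫ y, g y ∂(κ x))) ∂μ :=
          lintegral_const_mul' _ _ (by simp)
    _ ≤ ENNReal.ofReal (Real.exp (c₁ * t ^ 2 / 8)) *
        ENNReal.ofReal (Real.exp (t * ∫ x, ∫ y, g y ∂(κ x) ∂μ + c₂ * t ^ 2 / 8)) := by
          gcongr
          exact h₂ t
    _ = _ := by
          rw [← ENNReal.ofReal_mul (Real.exp_pos _).le, ← Real.exp_add]
          congr 2
          ring

lemma hasGaussianMGF_dirac {X : Type*} [MeasurableSpace X] {g : X → ℝ} (hg : Measurable g)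
    (x : X) : HasGaussianMGF (Measure.dirac x) g 0 := by
  intro t
  rw [lintegral_dirac' _ (by fun_prop), integral_dirac' _ _ hg.stronglyMeasurable]
  simp

lemma hasGaussianMGF_of_abs_sub_le {X : Type*} [MeasurableSpace X] {μ : Measure X}
    [IsProbabilityMeasure μ] {g : X → ℝ} (hg : Measurable g) {w : ℝ}
    (h : ∀ x y, |g x - g y| ≤ w) : HasGaussianMGF μ g (w ^ 2) := by
  have hne : Nonempty X := μ.nonempty_of_neZero
  obtain ⟨x₀⟩ := id hne
  have hw : 0 ≤ w := (abs_nonneg _).trans (h x₀ x₀)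
  have hbdd : BddBelow (Set.range g) :=
    ⟨g x₀ - w, by rintro _ ⟨x, rfl⟩; linarith [(abs_le.1 (h x x₀)).1]⟩
  have hmem : ∀ x, g x ∈ Set.Icc (⨅ y, g y) ((⨅ y, g y) + w) := fun x =>
    ⟨ciInf_le hbdd x, by
      have : g x - w ≤ ⨅ y, g y := le_ciInf fun y => by linarith [(abs_le.1 (h x y)).2]
      linarith⟩
  have hs := hasSubgaussianMGF_of_mem_Icc (μ := μ) hg.aemeasurable (ae_of_all _ hmem)
  intro t
  have hint := hs.integrable_exp_mul t
  have hle := hs.mgf_le t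
  simp only [mgf] at hle
  have hfac : ∀ x, ENNReal.ofReal (Real.exp (t * g x)) =
      ENNReal.ofReal (Real.exp (t * ∫ x, g x ∂μ)) *
        ENNReal.ofReal (Real.exp (t * (g x - ∫ x, g x ∂μ))) := fun x => by
    rw [← ENNReal.ofReal_mul (Real.exp_pos _).le, ← Real.exp_add]
    congr 2
    ring
  simp_rw [hfac]
  rw [lintegral_const_mul' _ _ (by simp), ← ofReal_integral_eq_lintegral_ofReal hint
    (ae_of_all _ fun _ => (Real.exp_pos _).le), ← ENNReal.ofReal_mul (Real.exp_pos _).le,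
    Real.exp_add]
  gcongr
  refine hle.trans_eq ?_
  congr 1
  simp [abs_of_nonneg hw]
  ring

end Concentration

section Product

variable {V H : Type*} [Fintype V]

lemma measurable_measure_pi {X : Type*} [MeasurableSpace X] [MeasurableSpace H]
    {p : X → V → Measure H} [∀ x v, IsProbabilityMeasure (p x v)]
    (hp : ∀ v, Measurable fun x => p x v) : Measurable fun x => Measure.pi (p x) := by
  refine Measurable.measure_of_isPiSystem_of_isProbabilityMeasure generateFrom_pi.symm
    isPiSystem_pi ?_
  rintro _ ⟨s, hs, rfl⟩
  simp_rw [Measure.pi_pi]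
  exact Finset.measurable_prod _ fun v _ =>
    (Measure.measurable_coe (hs v (Set.mem_univ v))).comp (hp v)

lemma measure_pi_dirac [MeasurableSpace H] (a : V → H) :
    Measure.pi (fun v => Measure.dirac (a v)) = Measure.dirac a := by
  classical
  refine Measure.pi_eq fun s hs => ?_
  simp_rw [Measure.dirac_apply' _ (MeasurableSet.univ_pi hs), Measure.dirac_apply' _ (hs _),
    Set.indicator_apply, Pi.one_apply, Finset.prod_ite_zero]
  simp

instance isProbabilityMeasure_update_dirac {ι : Type*} [DecidableEq ι] [MeasurableSpace H]
    (μ : ι → Measure H) [∀ v, IsProbabilityMeasure (μ v)] (i : ι) (h : H) (v : ι) :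
    IsProbabilityMeasure (Function.update μ i (Measure.dirac h) v) := by
  by_cases hv : v = i
  · subst hv; simp only [Function.update_self]; infer_instance
  · simp only [Function.update_of_ne hv]; infer_instance

lemma measurable_measure_pi_update_dirac [DecidableEq V] [MeasurableSpace H] (μ : V → Measure H)
    [∀ v, IsProbabilityMeasure (μ v)] (i : V) :
    Measurable fun h => Measure.pi (Function.update μ i (Measure.dirac h)) := by
  refine measurable_measure_pi fun v => ?_
  by_cases hv : v = i
  · subst hv; simpa using Measure.measurable_dirac
  · simp [Function.update_of_ne hv]

lemma measure_pi_eq_bind_update [DecidableEq V] [MeasurableSpace H] (μ : V → Measure H)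
    [∀ v, IsProbabilityMeasure (μ v)] (i : V) :
    Measure.pi μ = (μ i).bind fun h => Measure.pi (Function.update μ i (Measure.dirac h)) := by
  refine Measure.pi_eq fun s hs => ?_
  rw [Measure.bind_apply (MeasurableSet.univ_pi hs)]
  · have h1 : ∀ h, Measure.pi (Function.update μ i (Measure.dirac h)) (Set.univ.pi s) =
        (s i).indicator 1 h * ∏ v ∈ Finset.univ.erase i, μ v (s v) := fun h => by
      rw [Measure.pi_pi, ← Finset.mul_prod_erase _ _ (Finset.mem_univ i)]
      simp only [Function.update_self, Measure.dirac_apply' _ (hs i)]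
      congr 1
      exact Finset.prod_congr rfl fun v hv => by
        rw [Function.update_of_ne (Finset.ne_of_mem_erase hv)]
    simp_rw [h1]
    rw [lintegral_mul_const _ (measurable_one.indicator (hs i)), lintegral_indicator_one (hs i),
      Finset.mul_prod_erase _ (fun v => μ v (s v)) (Finset.mem_univ i)]
  · exact (measurable_measure_pi_update_dirac μ i).aemeasurable

variable [PseudoMetricSpace H] {w : V → ℝ} {g : (V → H) → ℝ}

lemma WeightedLipschitz.continuous (hg : WeightedLipschitz w g) (hw : ∀ v, 0 ≤ w v) :
    Continuous g := by
  refine (LipschitzWith.of_dist_le_mul (K := ∑ v, (w v).toNNReal) fun x y => ?_).continuous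
  rw [Real.dist_eq]
  refine (hg x y).trans ?_
  push_cast
  rw [Finset.sum_mul]
  refine Finset.sum_le_sum fun v _ => ?_
  rw [Real.coe_toNNReal _ (hw v)]
  exact mul_le_mul_of_nonneg_left (dist_le_pi_dist x y v) (hw v)

lemma WeightedLipschitz.abs_sub_le (hg : WeightedLipschitz w g) (hw : ∀ v, 0 ≤ w v)
    (hd : ∀ x y : H, dist x y ≤ 1) (x y : V → H) : |g x - g y| ≤ ∑ v, w v :=
  (hg x y).trans (Finset.sum_le_sum fun v _ => mul_le_of_le_one_right (hw v) (hd _ _))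

variable [MeasurableSpace H] [BorelSpace H] [SecondCountableTopology H]

lemma WeightedLipschitz.measurable (hg : WeightedLipschitz w g) (hw : ∀ v, 0 ≤ w v) :
    Measurable g :=
  (hg.continuous hw).measurable

lemma WeightedLipschitz.integrable (hg : WeightedLipschitz w g) (hw : ∀ v, 0 ≤ w v)
    (hd : ∀ x y : H, dist x y ≤ 1) (μ : Measure (V → H)) [IsProbabilityMeasure μ] :
    Integrable g μ := by
  obtain ⟨x₀⟩ := μ.nonempty_of_neZero
  refine Integrable.of_bound (hg.measurable hw).aestronglyMeasurable (|g x₀| + ∑ v, w v)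
    (ae_of_all _ fun x => ?_)
  rw [Real.norm_eq_abs]
  linarith [hg.abs_sub_le hw hd x x₀, abs_sub_abs_le_abs_sub (g x) (g x₀)]

lemma WeightedLipschitz.abs_integral_pi_sub_le (hg : WeightedLipschitz w g) (hw : ∀ v, 0 ≤ w v)
    (hd : ∀ x y : H, dist x y ≤ 1) {μ ν : V → Measure H} [∀ v, IsProbabilityMeasure (μ v)]
    [∀ v, IsProbabilityMeasure (ν v)] {r : V → ℝ} (h : ∀ v, TransportLE (μ v) (ν v) (r v)) :
    |∫ x, g x ∂(Measure.pi μ) - ∫ x, g x ∂(Measure.pi ν)| ≤ ∑ v, w v * r v := by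
  refine le_of_forall_pos_le_add fun η hη => ?_
  have hW : 0 ≤ ∑ v, w v := Finset.sum_nonneg fun v _ => hw v
  have hη' : 0 < η / (∑ v, w v + 1) := by positivity
  choose γ h1 h2 h3 using fun v => h v _ hη'
  have hγ : ∀ v, IsProbabilityMeasure (γ v) := fun v =>
    (Measure.isProbabilityMeasure_map_iff measurable_fst.aemeasurable).1
      (by rw [h1]; infer_instance)
  have hf : Measurable fun (z : V → H × H) v => (z v).1 := by fun_prop
  have hs : Measurable fun (z : V → H × H) v => (z v).2 := by fun_prop
  have hm1 : (Measure.pi γ).map (fun z v => (z v).1) = Measure.pi μ := by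
    have : ∀ v, SigmaFinite ((γ v).map Prod.fst) := fun v => by rw [h1]; infer_instance
    rw [Measure.pi_map_pi fun v => measurable_fst.aemeasurable]
    simp_rw [h1]
  have hm2 : (Measure.pi γ).map (fun z v => (z v).2) = Measure.pi ν := by
    have : ∀ v, SigmaFinite ((γ v).map Prod.snd) := fun v => by rw [h2]; infer_instance
    rw [Measure.pi_map_pi fun v => measurable_snd.aemeasurable]
    simp_rw [h2]
  have hgm := (hg.measurable hw).aestronglyMeasurable (μ := Measure.pi μ)
  have hgm' := (hg.measurable hw).aestronglyMeasurable (μ := Measure.pi ν)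
  have hi1 := hg.integrable hw hd (Measure.pi μ)
  have hi2 := hg.integrable hw hd (Measure.pi ν)
  rw [← hm1] at hgm hi1 ⊢
  rw [← hm2] at hgm' hi2 ⊢
  have hj1 : Integrable (fun z : V → H × H => g fun v => (z v).1) (Measure.pi γ) :=
    hi1.comp_measurable hf
  have hj2 : Integrable (fun z : V → H × H => g fun v => (z v).2) (Measure.pi γ) :=
    hi2.comp_measurable hs
  rw [integral_map hf.aemeasurable hgm, integral_map hs.aemeasurable hgm', ← integral_sub hj1 hj2]
  have hdi : ∀ v, Integrable (fun z : H × H => dist z.1 z.2) (γ v) := fun v =>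
    Integrable.of_bound measurable_dist.aestronglyMeasurable 1
      (ae_of_all _ fun z => by simpa [abs_of_nonneg dist_nonneg] using hd z.1 z.2)
  have hdi' : ∀ v, Integrable (fun z : V → H × H => w v * dist (z v).1 (z v).2)
      (Measure.pi γ) := fun v =>
    (integrable_comp_eval (X := fun _ => H × H) (f := fun z => dist z.1 z.2) (hdi v)).const_mul _
  calc _ ≤ ∫ z, |g (fun v => (z v).1) - g (fun v => (z v).2)| ∂(Measure.pi γ) :=
        abs_integral_le_integral_abs
    _ ≤ ∫ z, ∑ v, w v * dist (z v).1 (z v).2 ∂(Measure.pi γ) :=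
        integral_mono (hj1.sub hj2).abs
          (integrable_finsetSum _ fun v _ => hdi' v) fun z => hg _ _
    _ = ∑ v, w v * ∫ z, dist z.1 z.2 ∂(γ v) := by
        rw [integral_finsetSum _ fun v _ => hdi' v]
        refine Finset.sum_congr rfl fun v _ => ?_
        rw [integral_const_mul,
          integral_comp_eval (X := fun _ => H × H) (f := fun z => dist z.1 z.2)
            (hdi v).aestronglyMeasurable]
    _ ≤ ∑ v, w v * (r v + η / (∑ v, w v + 1)) :=
        Finset.sum_le_sum fun v _ => mul_le_mul_of_nonneg_left (h3 v) (hw v)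
    _ = ∑ v, w v * r v + (∑ v, w v) * (η / (∑ v, w v + 1)) := by
        simp_rw [mul_add, Finset.sum_add_distrib, Finset.sum_mul]
    _ ≤ ∑ v, w v * r v + η := by
        gcongr
        rw [← mul_div_assoc, div_le_iff₀ (by positivity)]
        nlinarith

lemma WeightedLipschitz.hasGaussianMGF_pi (hg : WeightedLipschitz w g) (hw : ∀ v, 0 ≤ w v)
    (hd : ∀ x y : H, dist x y ≤ 1) (s : Finset V) (a : V → H) (μ : V → Measure H)
    [∀ v, IsProbabilityMeasure (μ v)] (hμ : ∀ v ∉ s, μ v = Measure.dirac (a v)) :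
    HasGaussianMGF (Measure.pi μ) g (∑ v ∈ s, w v ^ 2) := by
  classical
  induction s using Finset.induction_on generalizing a μ with
  | empty =>
    have : μ = fun v => Measure.dirac (a v) := funext fun v => hμ v (Finset.notMem_empty v)
    subst this
    rw [measure_pi_dirac, Finset.sum_empty]
    exact hasGaussianMGF_dirac (hg.measurable hw) a
  | insert i s hi ih =>
    rw [Finset.sum_insert hi, add_comm, measure_pi_eq_bind_update μ i]
    refine HasGaussianMGF.bind (measurable_measure_pi_update_dirac μ i) (hg.measurable hw) ?_ (fun h => ?_) ?_
    · rw [← measure_pi_eq_bind_update μ i]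
      exact hg.integrable hw hd _
    · refine ih (Function.update a i h) _ fun v hv => ?_
      by_cases hvi : v = i
      · subst hvi; simp
      · simp [Function.update_of_ne hvi, hμ v (by simp [hvi, hv])]
    · have hlip : ∀ h h' : H, |∫ y, g y ∂(Measure.pi (Function.update μ i (Measure.dirac h))) -
          ∫ y, g y ∂(Measure.pi (Function.update μ i (Measure.dirac h')))| ≤ w i * dist h h' := by
        intro h h'
        have := hg.abs_integral_pi_sub_le hw hd
          (μ := Function.update μ i (Measure.dirac h))
          (ν := Function.update μ i (Measure.dirac h'))
          (r := fun v => if v = i then dist h h' else 0) fun v => by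
            by_cases hv : v = i
            · subst hv; simpa using transportLE_dirac h h'
            · simpa [Function.update_of_ne hv, hv] using transportLE_self (μ v)
        simpa using this
      refine hasGaussianMGF_of_abs_sub_le ?_ fun h h' =>
        (hlip h h').trans (mul_le_of_le_one_right (hw i) (hd h h'))
      refine (LipschitzWith.of_dist_le_mul (K := (w i).toNNReal)
        fun h h' => ?_).continuous.measurable
      rw [Real.dist_eq, Real.coe_toNNReal _ (hw i)]
      exact hlip h h'

end Product

namespace ParentTree

section Tree

variable {V : Type*} (T : ParentTree V)

lemma depth_parent_of_depth_eq_succ {v : V} {m : ℕ} (h : T.depth v = m + 1) :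
    T.depth (T.parent v) = m := by
  have h1 : T.depth v ≤ T.depth (T.parent v) + 1 :=
    Nat.sInf_le (by
      rw [Set.mem_ofPred_eq, Function.iterate_succ_apply]
      exact T.depth_spec _)
  have h2 : T.depth (T.parent v) ≤ m := Nat.sInf_le (by
    have := T.depth_spec v
    rwa [h, Function.iterate_succ_apply] at this)
  omega

lemma eq_root_of_depth_eq_zero {v : V} (h : T.depth v = 0) : v = T.root := by
  simpa [h] using T.depth_spec v

lemma depth_parent_iterate {r : ℕ} {v : V} {m : ℕ} (h : T.depth v = m + r) :
    T.depth (T.parent^[r] v) = m := by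
  induction r generalizing v with
  | zero => simpa using h
  | succ r ih =>
    rw [Function.iterate_succ_apply]
    exact ih (T.depth_parent_of_depth_eq_succ (by omega))

lemma depth_lt_card [Fintype V] (v : V) : T.depth v < Fintype.card V := by
  classical
  have h : Finset.range (T.depth v + 1) ⊆ Finset.univ.image T.depth := fun n hn => by
    rw [Finset.mem_range] at hn
    exact Finset.mem_image.2 ⟨T.parent^[T.depth v - n] v, Finset.mem_univ _,
      T.depth_parent_iterate (by omega)⟩
  have := (Finset.card_le_card h).trans Finset.card_image_le
  rwa [Finset.card_range, Finset.card_univ] at this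

lemma mem_desc {r : ℕ} {v w : V} :
    w ∈ T.Desc r v ↔ T.parent^[r] w = v ∧ T.depth w = T.depth v + r :=
  Iff.rfl

lemma card_desc_zero (v : V) : Nat.card (T.Desc 0 v) = 1 := by
  have : T.Desc 0 v = {v} := by
    ext w
    simp only [mem_desc, Function.iterate_zero, id_eq, add_zero, Set.mem_singleton_iff]
    exact ⟨fun h => h.1, fun h => ⟨h, h ▸ rfl⟩⟩
  simp [this]

/-- The Lipschitz weights of a Hamming-Lipschitz function after averaging out all the
coordinates at depth greater than `k`. -/
noncomputable def levelWeight (b : ℝ) (k : ℕ) (v : V) : ℝ :=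
  if T.depth v < k then 1 else if T.depth v = k then T.dgf b v else 0

lemma levelWeight_of_depth_eq {b : ℝ} {k : ℕ} {v : V} (h : T.depth v = k) :
    T.levelWeight b k v = T.dgf b v := by
  simp [levelWeight, h]

variable [Fintype V] {b : ℝ}

lemma summable_dgf (hb0 : 0 ≤ b) (hb1 : b < 1) (v : V) :
    Summable fun r : ℕ => (Nat.card (T.Desc r v) : ℝ) * b ^ r := by
  refine Summable.of_nonneg_of_le (fun r => by positivity) (fun r => ?_)
    ((summable_geometric_of_lt_one hb0 hb1).mul_left (Nat.card V : ℝ))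
  gcongr
  exact Nat.card_le_card_of_injective _ Subtype.val_injective

open Classical in
lemma card_desc_succ (r : ℕ) (u : V) :
    Nat.card (T.Desc (r + 1) u) =
      ∑ v with T.depth v = T.depth u + 1 ∧ T.parent v = u, Nat.card (T.Desc r v) := by
  have hcard : ∀ n w, Nat.card (T.Desc n w) = (Finset.univ.filter (· ∈ T.Desc n w)).card :=
    fun n w => by rw [Nat.card_eq_fintype_card, Fintype.card_subtype]
  simp_rw [hcard]
  rw [Finset.card_eq_sum_card_fiberwise (f := T.parent^[r])
    (t := Finset.univ.filter fun v => T.depth v = T.depth u + 1 ∧ T.parent v = u)]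
  · refine Finset.sum_congr rfl fun v hv => ?_
    simp only [Finset.mem_filter, Finset.mem_univ, true_and] at hv
    congr 1
    ext w
    simp only [Finset.mem_filter, Finset.mem_univ, true_and, mem_desc,
      Function.iterate_succ_apply']
    constructor
    · rintro ⟨⟨_, h2⟩, h3⟩
      exact ⟨h3, by omega⟩
    · rintro ⟨h1, h2⟩
      exact ⟨⟨by rw [h1, hv.2], by omega⟩, h1⟩
  · intro w hw
    simp only [mem_desc, Set.mem_ofPred_eq, Finset.coe_filter, Finset.mem_univ, true_and,
      Function.iterate_succ_apply'] at hw ⊢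
    exact ⟨T.depth_parent_iterate (by omega), hw.1⟩

open Classical in
lemma dgf_eq_one_add (hb0 : 0 ≤ b) (hb1 : b < 1) (u : V) :
    T.dgf b u =
      1 + ∑ v with T.depth v = T.depth u + 1 ∧ T.parent v = u, b * T.dgf b v := by
  rw [dgf, (T.summable_dgf hb0 hb1 u).tsum_eq_zero_add, T.card_desc_zero]
  simp only [Nat.cast_one, pow_zero, mul_one, card_desc_succ, Nat.cast_sum, Finset.sum_mul]
  congr 1
  rw [Summable.tsum_finsetSum]
  · refine Finset.sum_congr rfl fun v _ => ?_
    rw [dgf, ← tsum_mul_left]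
    congr 1 with r
    ring
  · intro v _
    refine ((T.summable_dgf hb0 hb1 v).mul_left b).congr fun r => ?_
    ring

lemma one_le_dgf (hb0 : 0 ≤ b) (hb1 : b < 1) (u : V) : 1 ≤ T.dgf b u := by
  rw [dgf, (T.summable_dgf hb0 hb1 u).tsum_eq_zero_add, T.card_desc_zero]
  simp only [Nat.cast_one, pow_zero, mul_one, le_add_iff_nonneg_right]
  exact tsum_nonneg fun r => by positivity

lemma Delta_pos (hb0 : 0 ≤ b) (hb1 : b < 1) : 0 < T.Delta b :=
  Real.sqrt_pos.2 <| Finset.sum_pos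
    (fun v _ => pow_pos (zero_lt_one.trans_le (T.one_le_dgf hb0 hb1 v)) 2)
    ⟨T.root, Finset.mem_univ _⟩

lemma sq_Delta : T.Delta b ^ 2 = ∑ v, T.dgf b v ^ 2 :=
  Real.sq_sqrt (Finset.sum_nonneg fun _ _ => sq_nonneg _)

lemma levelWeight_nonneg (hb0 : 0 ≤ b) (hb1 : b < 1) (k : ℕ) (v : V) :
    0 ≤ T.levelWeight b k v := by
  unfold levelWeight
  split_ifs
  · exact zero_le_one
  · exact zero_le_one.trans (T.one_le_dgf hb0 hb1 v)
  · exact le_rfl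

lemma levelWeight_card (v : V) : T.levelWeight b (Fintype.card V) v = 1 :=
  if_pos (T.depth_lt_card v)

open Classical in
lemma sum_levelWeight_succ (hb0 : 0 ≤ b) (hb1 : b < 1) (k : ℕ) (D : V → ℝ) :
    ∑ v, T.levelWeight b (k + 1) v * (if T.depth v = k + 1 then b * D (T.parent v) else D v) =
      ∑ v, T.levelWeight b k v * D v := by
  have h1 : ∀ v, T.levelWeight b (k + 1) v *
      (if T.depth v = k + 1 then b * D (T.parent v) else D v) =
      (if T.depth v < k + 1 then D v else 0) +
        if T.depth v = k + 1 then b * T.dgf b v * D (T.parent v) else 0 := fun v => by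
    rcases lt_trichotomy (T.depth v) (k + 1) with h | h | h
    · simp [levelWeight, h, h.ne]
    · simp [levelWeight, h]; ring
    · simp [levelWeight, h.not_gt, h.ne']
  simp_rw [h1]
  rw [Finset.sum_add_distrib, ← Finset.sum_filter (fun v => T.depth v = k + 1),
    ← Finset.sum_fiberwise (Finset.univ.filter _) T.parent, ← Finset.sum_add_distrib]
  refine Finset.sum_congr rfl fun u _ => ?_
  rw [Finset.sum_congr rfl (g := fun v => b * T.dgf b v * D u) fun v hv => by
    rw [(Finset.mem_filter.1 hv).2], ← Finset.sum_mul, Finset.filter_filter]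
  by_cases hu : T.depth u = k
  · rw [T.levelWeight_of_depth_eq hu, T.dgf_eq_one_add hb0 hb1 u, hu, if_pos (by omega)]
    ring
  · rw [Finset.filter_false_of_mem, Finset.sum_empty, levelWeight, if_neg hu]
    · rcases lt_or_gt_of_ne hu with h | h
      · simp [h, h.trans (Nat.lt_succ_self k)]
      · simp [h.not_gt, show ¬ T.depth u < k + 1 by omega]
    · rintro v - ⟨hv, rfl⟩
      exact hu (T.depth_parent_of_depth_eq_succ hv)

end Tree

section Markov

variable {V : Type*} [Fintype V] (T : ParentTree V) {H : Type*} [MeasurableSpace H]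

open Classical in
/-- The conditional laws of the coordinates when passing from level `k` to level `k + 1`. -/
noncomputable def levelKernel (q : V → Kernel H H) (k : ℕ) (x : V → H) (v : V) : Measure H :=
  if T.depth v = k + 1 then (q v) (x (T.parent v)) else Measure.dirac (x v)

lemma levelMeasure_succ (m : Measure H) (q : V → Kernel H H) (k : ℕ) :
    T.levelMeasure m q (k + 1) =
      (T.levelMeasure m q k).bind fun x => Measure.pi (T.levelKernel q k x) :=
  rfl

variable {m : Measure H} {q : V → Kernel H H}

instance isProbabilityMeasure_levelKernel [∀ v, IsMarkovKernel (q v)] (k : ℕ) (x : V → H)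
    (v : V) : IsProbabilityMeasure (T.levelKernel q k x v) := by
  unfold levelKernel
  split_ifs <;> infer_instance

lemma measurable_pi_levelKernel [∀ v, IsMarkovKernel (q v)] (k : ℕ) :
    Measurable fun x => Measure.pi (T.levelKernel q k x) := by
  refine measurable_measure_pi fun v => ?_
  unfold levelKernel
  split_ifs
  · exact (q v).measurable.comp (measurable_pi_apply _)
  · exact Measure.measurable_dirac.comp (measurable_pi_apply _)

lemma isProbabilityMeasure_levelMeasure [IsProbabilityMeasure m] [∀ v, IsMarkovKernel (q v)]
    (k : ℕ) : IsProbabilityMeasure (T.levelMeasure m q k) := by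
  induction k with
  | zero => exact Measure.isProbabilityMeasure_map (by fun_prop)
  | succ k ih =>
    rw [levelMeasure_succ]
    exact isProbabilityMeasure_bind (T.measurable_pi_levelKernel k).aemeasurable
      (ae_of_all _ fun x => inferInstance)

variable [PseudoMetricSpace H] [BorelSpace H] [SecondCountableTopology H]
  {b : ℝ} {g : (V → H) → ℝ}

lemma weightedLipschitz_integral_levelKernel [∀ v, IsMarkovKernel (q v)]
    (hb0 : 0 ≤ b) (hb1 : b < 1) (hd : ∀ x y : H, dist x y ≤ 1)
    (hq : ∀ v, v ≠ T.root → ∀ x y : H, transportCost dist ((q v) x) ((q v) y) ≤ b * dist x y)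
    {k : ℕ} (hg : WeightedLipschitz (T.levelWeight b (k + 1)) g) :
    WeightedLipschitz (T.levelWeight b k)
      fun x => ∫ y, g y ∂(Measure.pi (T.levelKernel q k x)) := by
  classical
  intro x y
  rw [← T.sum_levelWeight_succ hb0 hb1 k fun v => dist (x v) (y v)]
  refine hg.abs_integral_pi_sub_le (T.levelWeight_nonneg hb0 hb1 _) hd fun v => ?_
  unfold levelKernel
  split_ifs with h
  · refine TransportLE.of_transportCost_le (hq v ?_ _ _)
    rintro rfl
    simp [T.depth_root] at h
  · exact transportLE_dirac _ _

open Classical in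
lemma hasGaussianMGF_levelMeasure [IsProbabilityMeasure m] [∀ v, IsMarkovKernel (q v)]
    (hb0 : 0 ≤ b) (hb1 : b < 1) (hd : ∀ x y : H, dist x y ≤ 1)
    (hq : ∀ v, v ≠ T.root → ∀ x y : H, transportCost dist ((q v) x) ((q v) y) ≤ b * dist x y)
    {k : ℕ} (hg : WeightedLipschitz (T.levelWeight b k) g) :
    HasGaussianMGF (T.levelMeasure m q k) g (∑ v with T.depth v < k + 1, T.dgf b v ^ 2) := by
  induction k generalizing g with
  | zero =>
    have hw := T.levelWeight_nonneg hb0 hb1 0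
    have hconst : Measurable fun (h : H) (_ : V) => h := by fun_prop
    have hgm := hg.measurable hw
    have hiff : ∀ v, T.depth v = 0 ↔ v = T.root := fun v =>
      ⟨T.eq_root_of_depth_eq_zero, fun h => h ▸ T.depth_root⟩
    have hsum : ∀ D : V → ℝ, ∑ v with T.depth v < 0 + 1, D v = D T.root := fun D => by
      simp [hiff, Finset.sum_filter]
    rw [hsum fun v => T.dgf b v ^ 2]
    have key : HasGaussianMGF m (fun h => g fun _ => h) (T.dgf b T.root ^ 2) := by
      refine hasGaussianMGF_of_abs_sub_le (hgm.comp hconst) fun h h' => ?_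
      refine (hg.abs_sub_le hw hd _ _).trans_eq ?_
      simp [levelWeight, hiff]
    intro t
    have := key t
    rwa [levelMeasure, lintegral_map (by fun_prop) hconst,
      integral_map hconst.aemeasurable hgm.aestronglyMeasurable]
  | succ k ih =>
    have hw := T.levelWeight_nonneg hb0 hb1 (k + 1)
    have := T.isProbabilityMeasure_levelMeasure (m := m) (q := q)
    have hsum : ∑ v with T.depth v < k + 1 + 1, T.dgf b v ^ 2 =
        ∑ v with T.depth v = k + 1, T.levelWeight b (k + 1) v ^ 2 +
          ∑ v with T.depth v < k + 1, T.dgf b v ^ 2 := by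
      have h1 : ∑ v with T.depth v = k + 1, T.levelWeight b (k + 1) v ^ 2 =
          ∑ v with T.depth v = k + 1, T.dgf b v ^ 2 := Finset.sum_congr rfl fun v hv => by
        rw [T.levelWeight_of_depth_eq (Finset.mem_filter.1 hv).2]
      rw [h1, ← Finset.sum_union]
      · congr 1
        ext v
        simp only [Finset.mem_filter, Finset.mem_union, Finset.mem_univ, true_and]
        omega
      · rw [Finset.disjoint_filter]
        intro v _ h
        omega
    rw [hsum, levelMeasure_succ]
    refine HasGaussianMGF.bind (T.measurable_pi_levelKernel k) (hg.measurable hw) ?_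
      (fun x => ?_) (ih (T.weightedLipschitz_integral_levelKernel hb0 hb1 hd hq hg))
    · rw [← levelMeasure_succ]
      exact hg.integrable hw hd _
    · refine hg.hasGaussianMGF_pi hw hd _ x _ fun v hv => ?_
      rw [levelKernel, if_neg (by simpa using hv)]

variable {T} in
lemma IsLipMarkov.measure_lt_le {ν : Measure (V → H)} (hν : T.IsLipMarkov b ν)
    (hb0 : 0 ≤ b) (hb1 : b < 1) (hd : ∀ x y : H, dist x y ≤ 1) {f : (V → H) → ℝ}
    (hf : ∀ x y, |f x - f y| ≤ nhdist x y) (hf0 : ∫ x, f x ∂ν = 0) {ε : ℝ} (hε : 0 < ε) :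
    ν {x | ε < f x} ≤
      ENNReal.ofReal (Real.exp (-2 * (Fintype.card V * ε) ^ 2 / T.Delta b ^ 2)) := by
  classical
  obtain ⟨m, q, hm, hqm, hq, rfl⟩ := hν
  have hn : (0 : ℝ) < Fintype.card V :=
    Nat.cast_pos.2 ((Nat.zero_le _).trans_lt (T.depth_lt_card T.root))
  set g : (V → H) → ℝ := fun x => Fintype.card V * f x with hg
  have hgL : WeightedLipschitz (T.levelWeight b (Fintype.card V)) g := fun x y => by
    simp_rw [levelWeight_card, one_mul, hg, ← mul_sub, abs_mul, abs_of_pos hn]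
    have := hf x y
    rwa [nhdist, inv_mul_eq_div, le_div_iff₀ hn, mul_comm] at this
  have hmgf := T.hasGaussianMGF_levelMeasure (m := m) hb0 hb1 hd hq hgL
  rw [Finset.filter_true_of_mem fun v _ => (T.depth_lt_card v).trans (Nat.lt_succ_self _),
    ← sq_Delta] at hmgf
  have hset : {x | ε < f x} = {x | Fintype.card V * ε < g x} := by
    ext x
    simp [hg, hn]
  rw [hset]
  exact hmgf.measure_lt_le (hgL.measurable (T.levelWeight_nonneg hb0 hb1 _))
    (by simp [hg, integral_const_mul, hf0]) (pow_pos (T.Delta_pos hb0 hb1) 2) (by positivity)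

end Markov

end ParentTree

/-- **Corollary (Lévy families from `Δ_k` asymptotics).** For a sequence of finite rooted
trees `T_k` with `|V_k| → ∞`, carrying `b`-Lipschitz Markov measures `ν_k`: if
`Δ_k = o(|V_k|)` then `(H^{V_k}, d, ν_k)` is a Lévy family (the concentration suprema tend
to `0`), and if `Δ_k = O(√|V_k|)` then it is a normal Lévy family. -/
theorem markov_levy_family
    {V : ℕ → Type} [∀ k, Fintype (V k)] (T : ∀ k, ParentTree (V k))
    {H : Type} [MetricSpace H] [TopologicalSpace.SeparableSpace H] [CompleteSpace H]
    [MeasurableSpace H] [BorelSpace H]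
    (hdiam : EMetric.diam (Set.univ : Set H) ≤ 1)
    {b : ℝ} (hb0 : 0 ≤ b) (hb1 : b < 1)
    (hcard : Filter.Tendsto (fun k => Fintype.card (V k)) Filter.atTop Filter.atTop)
    (ν : ∀ k, MeasureTheory.Measure (V k → H)) (hν : ∀ k, (T k).IsLipMarkov b (ν k)) :
    ((Filter.Tendsto (fun k => (T k).Delta b / (Fintype.card (V k) : ℝ))
        Filter.atTop (nhds 0)) →
      ∀ ε > (0:ℝ), ∀ η > (0:ℝ), ∃ K : ℕ, ∀ k ≥ K, ∀ f : (V k → H) → ℝ,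
        (∀ x y : V k → H, |f x - f y| ≤ nhdist x y) → (∫ x, f x ∂(ν k)) = 0 →
        (ν k) {x | ε < f x} ≤ ENNReal.ofReal η) ∧
    ((∃ C : ℝ, ∀ k, (T k).Delta b ≤ C * Real.sqrt (Fintype.card (V k))) →
      ∀ ε > (0:ℝ), ∃ c₁ > (0:ℝ), ∃ c₂ > (0:ℝ), ∀ k, ∀ f : (V k → H) → ℝ,
        (∀ x y : V k → H, |f x - f y| ≤ nhdist x y) → (∫ x, f x ∂(ν k)) = 0 →
        (ν k) {x | ε < f x} ≤
          ENNReal.ofReal (c₁ * Real.exp (-c₂ * (Fintype.card (V k) : ℝ) * ε ^ 2))) := by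
  have : SecondCountableTopology H := UniformSpace.secondCountable_of_separable H
  have hd : ∀ x y : H, dist x y ≤ 1 := fun x y => by
    have h := (Metric.edist_le_ediam_of_mem (Set.mem_univ x) (Set.mem_univ y)).trans hdiam
    rwa [edist_dist, ENNReal.ofReal_le_one] at h
  have hn : ∀ k, (0 : ℝ) < Fintype.card (V k) := fun k =>
    Nat.cast_pos.2 ((Nat.zero_le _).trans_lt ((T k).depth_lt_card (T k).root))
  have hΔ : ∀ k, 0 < (T k).Delta b := fun k => (T k).Delta_pos hb0 hb1
  constructor
  · intro hlim ε hε η hη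
    have hlim2 : Tendsto (fun k => ((T k).Delta b / (Fintype.card (V k) : ℝ)) ^ 2 / (2 * ε ^ 2))
        atTop (𝓝 0) := by
      simpa using (hlim.pow 2).div_const (2 * ε ^ 2)
    obtain ⟨K, hK⟩ := eventually_atTop.1 (hlim2.eventually (gt_mem_nhds hη))
    refine ⟨K, fun k hk f hf hf0 =>
      ((hν k).measure_lt_le hb0 hb1 hd hf hf0 hε).trans
        (ENNReal.ofReal_le_ofReal ((hK k hk).le.trans' ?_))⟩
    have hx : 0 < 2 * (Fintype.card (V k) * ε) ^ 2 / (T k).Delta b ^ 2 := by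
      have := hn k
      have := hΔ k
      positivity
    calc Real.exp (-2 * (Fintype.card (V k) * ε) ^ 2 / (T k).Delta b ^ 2)
        = (Real.exp (2 * (Fintype.card (V k) * ε) ^ 2 / (T k).Delta b ^ 2))⁻¹ := by
          rw [← Real.exp_neg]
          congr 1
          ring
      _ ≤ (2 * (Fintype.card (V k) * ε) ^ 2 / (T k).Delta b ^ 2)⁻¹ := by
          gcongr
          linarith [Real.add_one_le_exp (2 * (Fintype.card (V k) * ε) ^ 2 / (T k).Delta b ^ 2)]
      _ = _ := by
          have := (hn k).ne'
          have := (hΔ k).ne'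
          field_simp
  · rintro ⟨C, hC⟩ ε hε
    refine ⟨1, one_pos, 2 / (C ^ 2 + 1), by positivity, fun k f hf hf0 =>
      ((hν k).measure_lt_le hb0 hb1 hd hf hf0 hε).trans
        (ENNReal.ofReal_le_ofReal ?_)⟩
    rw [one_mul]
    refine Real.exp_le_exp.2 ?_
    have hsq : (T k).Delta b ^ 2 ≤ (C ^ 2 + 1) * Fintype.card (V k) := by
      have h := pow_le_pow_left₀ (hΔ k).le (hC k) 2
      rw [mul_pow, Real.sq_sqrt (hn k).le] at h
      linarith [hn k]
    have hΔ2 : 0 < (T k).Delta b ^ 2 := pow_pos (hΔ k) 2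
    have hkey : 2 / (C ^ 2 + 1) * (Fintype.card (V k) : ℝ) * ε ^ 2 ≤
        2 * (Fintype.card (V k) * ε) ^ 2 / (T k).Delta b ^ 2 := by
      rw [le_div_iff₀ hΔ2]
      calc _ ≤ 2 / (C ^ 2 + 1) * (Fintype.card (V k) : ℝ) * ε ^ 2 *
            ((C ^ 2 + 1) * Fintype.card (V k)) := by
              have := hn k
              gcongr
        _ = _ := by field_simp
    rw [neg_mul, neg_mul, neg_mul, neg_div]
    exact neg_le_neg hkey
end

section
/- Let T be an infinite locally finite rooted tree, let b ∈ [0,1), and for each k let T_k be the subtree induced by the vertices within distance k of the root, with vertex set V_k and Δ_k the ℓ² norm of the descendant generating function of T_k with parameter b. If b² · maxgr T < 1, where maxgr T = limsup_{r→∞} max_{v∈V} |D_r(v)|^{1/r}, then Δ_k = O(√|V_k|) as k → ∞. -/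
open MeasureTheory ProbabilityTheory Filter Topology
open scoped ENNReal NNReal

namespace ParentTree

variable {V : Type*} (T : ParentTree V)

lemma depth_iterate_parent {v : V} {s : ℕ} (hs : s ≤ T.depth v) :
    T.depth (T.parent^[s] v) + s = T.depth v := by
  apply le_antisymm
  · have h : T.depth (T.parent^[s] v) ≤ T.depth v - s := by
      apply Nat.sInf_le
      rw [Set.mem_ofPred_eq, ← Function.iterate_add_apply, Nat.sub_add_cancel hs]
      exact T.depth_spec v
    omega
  · apply Nat.sInf_le
    rw [Set.mem_ofPred_eq, Function.iterate_add_apply]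
    exact T.depth_spec _

lemma depth_trunc (k : ℕ) (v : {v : V // T.depth v ≤ k}) :
    (T.trunc k).depth v = T.depth v.1 := by
  unfold depth
  congr 1
  ext n
  simp only [Set.mem_ofPred_eq, ← T.truncParent_iterate k n v]
  exact Subtype.ext_iff

lemma finite_setOf_depth_le [∀ k : ℕ, Finite {v : V // T.depth v ≤ k}] (k : ℕ) :
    {v : V | T.depth v ≤ k}.Finite :=
  Set.finite_coe_iff.1 (inferInstanceAs (Finite {v : V // T.depth v ≤ k}))

lemma finite_desc [∀ k : ℕ, Finite {v : V // T.depth v ≤ k}] (r : ℕ) (v : V) :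
    (T.Desc r v).Finite :=
  (T.finite_setOf_depth_le (T.depth v + r)).subset fun _ hw => hw.2.le

lemma card_desc_trunc_le [∀ k : ℕ, Finite {v : V // T.depth v ≤ k}] (k r : ℕ)
    (v : {v : V // T.depth v ≤ k}) :
    Nat.card ((T.trunc k).Desc r v) ≤ Nat.card (T.Desc r v.1) := by
  have : Finite (T.Desc r v.1) := T.finite_desc r v.1
  have hmem (w : (T.trunc k).Desc r v) : w.1.1 ∈ T.Desc r v.1 := by
    refine ⟨?_, ?_⟩
    · rw [← T.truncParent_iterate k r w.1]
      exact congrArg Subtype.val w.2.1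
    · have h := w.2.2
      rwa [depth_trunc, depth_trunc] at h
  refine Nat.card_le_card_of_injective
    (fun w : (T.trunc k).Desc r v => (⟨w.1.1, hmem w⟩ : T.Desc r v.1)) fun w w' h => ?_
  exact Subtype.ext (Subtype.ext (Subtype.mk.inj h))

lemma card_desc_le_card_desc_iterate_parent [∀ k : ℕ, Finite {v : V // T.depth v ≤ k}]
    {r s : ℕ} {v : V} (hs : s ≤ T.depth v) :
    Nat.card (T.Desc r v) ≤ Nat.card (T.Desc (s + r) (T.parent^[s] v)) := by
  refine Nat.card_mono (T.finite_desc _ _) fun w hw => ⟨?_, ?_⟩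
  · rw [Function.iterate_add_apply, hw.1]
  · have := T.depth_iterate_parent hs
    have := hw.2
    omega

/-- Every vertex has at most one ancestor `r` generations above it. -/
lemma sum_card_desc_le [Fintype V] (r : ℕ) :
    ∑ v : V, Nat.card (T.Desc r v) ≤ Fintype.card V := by
  rw [← Nat.card_sigma, ← Nat.card_eq_fintype_card]
  refine Nat.card_le_card_of_injective (fun x : Σ v, T.Desc r v => x.2.1) ?_
  rintro ⟨v, w, hw⟩ ⟨v', w', hw'⟩ h
  obtain rfl : w = w' := h
  obtain rfl : v = v' := hw.1.symm.trans hw'.1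
  rfl

lemma dgf_trunc (b : ℝ) (k : ℕ) (v : {v : V // T.depth v ≤ k}) :
    (T.trunc k).dgf b v =
      ∑ r ∈ Finset.range (k + 1), (Nat.card ((T.trunc k).Desc r v) : ℝ) * b ^ r := by
  refine tsum_eq_sum fun r hr => ?_
  have : IsEmpty ((T.trunc k).Desc r v) := by
    refine ⟨fun w => hr ?_⟩
    have h := w.2.2
    rw [depth_trunc, depth_trunc] at h
    have := w.1.2
    rw [Finset.mem_range]
    omega
  simp

/-- If `b² · maxgr T < 1`, then `|D_r(v)| b^{2r}` decays geometrically, uniformly in `v`. -/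
lemma exists_card_desc_mul_le [∀ k : ℕ, Finite {v : V // T.depth v ≤ k}]
    {b : ℝ} (hb0 : 0 ≤ b) (hb1 : b < 1) (hgr : ENNReal.ofReal (b ^ 2) * T.maxgr < 1) :
    ∃ K q : ℝ, 0 ≤ K ∧ 0 < q ∧ q < 1 ∧
      ∀ r v, (Nat.card (T.Desc r v) : ℝ) * (b ^ r) ^ 2 ≤ K * (q ^ r) ^ 2 := by
  rcases hb0.eq_or_lt with rfl | hb
  · refine ⟨1, 1 / 2, by norm_num, by norm_num, by norm_num, fun r v => ?_⟩
    rcases r with _ | r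
    · have : Nat.card (T.Desc 0 v) ≤ 1 := by
        have : Subsingleton (T.Desc 0 v) :=
          ⟨fun w w' => Subtype.ext (w.2.1.trans w'.2.1.symm)⟩
        exact Finite.card_le_one_iff_subsingleton.mpr this
      simpa using this
    · simp only [ne_eq, Nat.succ_ne_zero, not_false_eq_true, zero_pow, OfNat.ofNat_ne_zero,
        mul_zero]
      positivity
  have hb2 : 0 < b ^ 2 := by positivity
  have hne : ENNReal.ofReal (b ^ 2) ≠ 0 := by simpa using hb.ne'
  have hlt : T.maxgr < (ENNReal.ofReal (b ^ 2))⁻¹ := by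
    rw [← one_div]
    refine (ENNReal.lt_div_iff_mul_lt (Or.inl hne) (Or.inl ENNReal.ofReal_ne_top)).2 ?_
    rwa [mul_comm]
  obtain ⟨c, hc, hcb⟩ := exists_between hlt
  have hct : c ≠ ⊤ := hcb.ne_top
  have hev := eventually_lt_of_limsup_lt hc
  obtain ⟨R, hR⟩ := eventually_atTop.1 (hev.and (eventually_ge_atTop 1))
  have hcr : ∀ r ≥ R, ∀ v, (Nat.card (T.Desc r v) : ℝ) ≤ c.toReal ^ r := by
    intro r hr v
    obtain ⟨hsup, h1⟩ := hR r hr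
    have h : (Nat.card (T.Desc r v) : ℝ≥0∞) ^ (1 / (r : ℝ)) ≤ c :=
      (le_iSup (fun v : V => (Nat.card (T.Desc r v) : ℝ≥0∞) ^ (1 / (r : ℝ))) v).trans hsup.le
    have h' : (Nat.card (T.Desc r v) : ℝ≥0∞) ≤ c ^ r := by
      rw [one_div, ENNReal.rpow_inv_le_iff (by exact_mod_cast h1)] at h
      simpa using h
    have := ENNReal.toReal_mono (ENNReal.pow_ne_top hct) h'
    simpa using this
  have hcb' : b ^ 2 * c.toReal < 1 := by
    have h := ENNReal.toReal_strict_mono (ENNReal.inv_ne_top.2 hne) hcb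
    rw [ENNReal.toReal_inv, ENNReal.toReal_ofReal hb2.le] at h
    rwa [← lt_inv_mul_iff₀ hb2, mul_one]
  have hc0 : 0 ≤ c.toReal := ENNReal.toReal_nonneg
  set m := max (b ^ 2 * c.toReal) (b ^ 2) with hm
  have hm0 : 0 < m := hb2.trans_le (le_max_right _ _)
  have hm1 : m < 1 := max_lt hcb' (by nlinarith)
  have hq : ∀ r : ℕ, (√m ^ r) ^ 2 = m ^ r := fun r => by
    rw [pow_right_comm, Real.sq_sqrt hm0.le]
  have hbm : ∀ r : ℕ, (b ^ 2) ^ r ≤ m ^ r := fun r =>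
    pow_le_pow_left₀ hb2.le (le_max_right _ _) r
  refine ⟨1 + c.toReal ^ R + Nat.card {v : V | T.depth v ≤ R}, √m, by positivity,
    Real.sqrt_pos.2 hm0, (Real.sqrt_lt' one_pos).2 (by simpa using hm1), fun r v => ?_⟩
  rw [hq, pow_right_comm]
  have hcR : 0 ≤ c.toReal ^ R := pow_nonneg hc0 R
  have hN : (0 : ℝ) ≤ Nat.card {v : V | T.depth v ≤ R} := Nat.cast_nonneg _
  by_cases hr : R ≤ r
  · calc (Nat.card (T.Desc r v) : ℝ) * (b ^ 2) ^ r ≤ c.toReal ^ r * (b ^ 2) ^ r := by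
          gcongr; exact hcr r hr v
      _ = (b ^ 2 * c.toReal) ^ r := by rw [mul_pow, mul_comm]
      _ ≤ m ^ r := pow_le_pow_left₀ (by positivity) (le_max_left _ _) r
      _ ≤ _ := le_mul_of_one_le_left (by positivity) (by linarith)
  · refine mul_le_mul ?_ (hbm r) (by positivity) (by positivity)
    by_cases hv : R - r ≤ T.depth v
    · have h := T.card_desc_le_card_desc_iterate_parent (r := r) hv
      rw [Nat.sub_add_cancel (by omega)] at h
      have h' := hcr R le_rfl (T.parent^[R - r] v)
      have : (Nat.card (T.Desc r v) : ℝ) ≤ Nat.card (T.Desc R (T.parent^[R - r] v)) := by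
        exact_mod_cast h
      linarith
    · have h : Nat.card (T.Desc r v) ≤ Nat.card {v : V | T.depth v ≤ R} :=
        Nat.card_mono (T.finite_setOf_depth_le R)
          fun w hw => by
            have := hw.2
            rw [Set.mem_ofPred_eq]
            omega
      have h' : (Nat.card (T.Desc r v) : ℝ) ≤ Nat.card {v : V | T.depth v ≤ R} := by
        exact_mod_cast h
      linarith

end ParentTree

/-- A weighted Cauchy–Schwarz bound. -/
lemma sq_sum_mul_le_of_mul_sq_le {s : Finset ℕ} {d : ℕ → ℝ} {b q K : ℝ} (hd : ∀ r, 0 ≤ d r)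
    (hq : 0 < q) (h : ∀ r, d r * (b ^ r) ^ 2 ≤ K * (q ^ r) ^ 2) :
    (∑ r ∈ s, d r * b ^ r) ^ 2 ≤ (∑ r ∈ s, q ^ r) * ∑ r ∈ s, K * q ^ r * d r := by
  refine Finset.sum_sq_le_sum_mul_sum_of_sq_le_mul s (fun r _ => by positivity) ?_ ?_
  · intro r _
    refine mul_nonneg (nonneg_of_mul_nonneg_left ?_ (pow_pos hq r)) (hd r)
    rw [mul_assoc, ← sq]
    exact (mul_nonneg (hd r) (sq_nonneg _)).trans (h r)
  · intro r _
    nlinarith [mul_le_mul_of_nonneg_left (h r) (hd r)]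

/-- **Theorem (sufficient condition for `Δ_k = O(√|V_k|)`).** If `T` is an infinite,
locally finite rooted tree, `b ∈ [0,1)` and `b² · maxgr T < 1`, then `Δ_k = O(√|V_k|)`,
where `Δ_k` is the `ℓ²` norm of the descendant generating function of the depth-`k`
truncation `T_k` and `V_k` is its vertex set. -/
theorem delta_big_O_of_maxgr
    {V : Type} [Infinite V] (T : ParentTree V)
    [∀ k : ℕ, Fintype {v : V // T.depth v ≤ k}]
    (hlf : ∀ v : V, (T.children v).Finite)
    {b : ℝ} (hb0 : 0 ≤ b) (hb1 : b < 1)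
    (hgr : ENNReal.ofReal (b ^ 2) * T.maxgr < 1) :
    ∃ C : ℝ, ∀ k : ℕ,
      (T.trunc k).Delta b ≤ C * Real.sqrt (Fintype.card {v : V // T.depth v ≤ k}) := by
  obtain ⟨K, q, hK, hq0, hq1, h⟩ := T.exists_card_desc_mul_le hb0 hb1 hgr
  have hA : ∀ k : ℕ, ∑ r ∈ Finset.range k, q ^ r ≤ (1 - q)⁻¹ := fun k => by
    rw [← tsum_geometric_of_lt_one hq0.le hq1]
    exact (summable_geometric_of_lt_one hq0.le hq1).sum_le_tsum _ fun r _ => by positivity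
  have hq : 0 < (1 - q)⁻¹ := inv_pos.2 (sub_pos.2 hq1)
  refine ⟨√K * (1 - q)⁻¹, fun k => ?_⟩
  set N := Fintype.card {v : V // T.depth v ≤ k}
  set S := ∑ r ∈ Finset.range (k + 1), q ^ r
  have hS : 0 ≤ S := Finset.sum_nonneg fun r _ => by positivity
  refine Real.sqrt_le_iff.2 ⟨by positivity, ?_⟩
  calc ∑ v, (T.trunc k).dgf b v ^ 2
      ≤ ∑ v, S * ∑ r ∈ Finset.range (k + 1),
          K * q ^ r * (Nat.card ((T.trunc k).Desc r v) : ℝ) := by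
        refine Finset.sum_le_sum fun v _ => ?_
        rw [T.dgf_trunc]
        refine sq_sum_mul_le_of_mul_sq_le (fun r => Nat.cast_nonneg _) hq0 fun r =>
          le_trans ?_ (h r v.1)
        gcongr
        exact T.card_desc_trunc_le k r v
    _ = S * ∑ r ∈ Finset.range (k + 1), K * q ^ r *
          ((∑ v, Nat.card ((T.trunc k).Desc r v) : ℕ) : ℝ) := by
        rw [← Finset.mul_sum, Finset.sum_comm]
        simp_rw [Nat.cast_sum, Finset.mul_sum]
    _ ≤ S * ∑ r ∈ Finset.range (k + 1), K * q ^ r * (N : ℝ) := by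
        gcongr with r
        exact (T.trunc k).sum_card_desc_le r
    _ = K * N * S ^ 2 := by
        rw [← Finset.sum_mul, ← Finset.mul_sum]
        ring
    _ ≤ K * N * (1 - q)⁻¹ ^ 2 := by
        gcongr
        exact hA (k + 1)
    _ = (√K * (1 - q)⁻¹ * √(N : ℝ)) ^ 2 := by
        rw [mul_pow, mul_pow, Real.sq_sqrt hK, Real.sq_sqrt (Nat.cast_nonneg _)]
        ring
end

section
/- Let T be an infinite locally finite rooted tree, let b ∈ [0,1), and for each k let T_k be the subtree induced by the vertices within distance k of the root, with vertex set V_k and Δ_k the ℓ² norm of the descendant generating function of T_k with parameter b. If b² · bargr T > 1, where bargr T = limsup_{r→∞} |D_r(ρ)|^{1/r}, then it is not the case that Δ_k = O(√|V_k|). -/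
open MeasureTheory ProbabilityTheory Filter Topology
open scoped ENNReal NNReal

namespace ParentTree

variable {V : Type*} (T : ParentTree V)

lemma mem_Desc_root {r : ℕ} {v : V} : v ∈ T.Desc r T.root ↔ T.depth v = r := by
  simp only [Desc, Set.mem_ofPred_eq, T.depth_root, zero_add, and_iff_right_iff_imp]
  rintro rfl
  exact T.depth_spec v

lemma dgf_root_trunc (b : ℝ) (k : ℕ) [Fintype {v : V // T.depth v ≤ k}] :
    (T.trunc k).dgf b (T.trunc k).root =
      ∑ v : {v : V // T.depth v ≤ k}, b ^ T.depth v.1 := by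
  have hcard (r : ℕ) : Nat.card ((T.trunc k).Desc r (T.trunc k).root) =
      (Finset.univ.filter fun v : {v : V // T.depth v ≤ k} => T.depth v.1 = r).card := by
    rw [← Nat.card_eq_finsetCard]
    refine Nat.card_congr (Equiv.subtypeEquivRight fun v => ?_)
    simp [mem_Desc_root, depth_trunc]
  have hmaps : ∀ v ∈ (Finset.univ : Finset {v : V // T.depth v ≤ k}),
      T.depth v.1 ∈ Finset.range (k + 1) := fun v _ =>
    Finset.mem_range.2 (Nat.lt_succ_of_le v.2)
  rw [dgf, tsum_eq_sum (s := Finset.range (k + 1)), ← Finset.sum_fiberwise_of_maps_to hmaps]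
  · refine Finset.sum_congr rfl fun r _ => ?_
    rw [hcard, ← nsmul_eq_mul]
    refine (Finset.sum_eq_card_nsmul fun v hv => ?_).symm
    rw [(Finset.mem_filter.1 hv).2]
  · intro r hr
    rw [hcard, Finset.card_eq_zero.2, Nat.cast_zero, zero_mul]
    refine Finset.filter_eq_empty_iff.2 fun v hv hvr => hr (hvr ▸ hmaps v hv)

lemma dgf_le_Delta [Fintype V] (b : ℝ) (v : V) : T.dgf b v ≤ T.Delta b :=
  Real.le_sqrt_of_sq_le
    (Finset.single_le_sum (f := fun v => T.dgf b v ^ 2) (fun _ _ => sq_nonneg _)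
      (Finset.mem_univ v))

lemma card_mul_pow_le_Delta_trunc {b : ℝ} (hb0 : 0 ≤ b) (hb1 : b ≤ 1) (k : ℕ)
    [Fintype {v : V // T.depth v ≤ k}] :
    (Fintype.card {v : V // T.depth v ≤ k} : ℝ) * b ^ k ≤ (T.trunc k).Delta b := by
  refine le_trans ?_ ((T.trunc k).dgf_le_Delta b (T.trunc k).root)
  rw [dgf_root_trunc, ← nsmul_eq_mul]
  exact Finset.card_nsmul_le_sum _ _ _ fun v _ => pow_le_pow_of_le_one hb0 hb1 v.2

lemma card_Desc_root_le (k : ℕ) [Fintype {v : V // T.depth v ≤ k}] :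
    Nat.card (T.Desc k T.root) ≤ Fintype.card {v : V // T.depth v ≤ k} := by
  rw [← Nat.card_eq_fintype_card]
  exact Nat.card_mono (t := {v : V | T.depth v ≤ k}) (Finite.of_fintype {v : V // T.depth v ≤ k})
    fun v hv => (T.mem_Desc_root.1 hv).le

lemma bargr_le_of_card_mul_pow_le {c M : ℝ} (hc : 0 < c) (hM : 0 < M)
    (h : ∀ k : ℕ, (Nat.card (T.Desc k T.root) : ℝ) * c ^ k ≤ M) :
    T.bargr ≤ ENNReal.ofReal c⁻¹ := by
  have hlim : Tendsto (fun k : ℕ => ENNReal.ofReal (M ^ (1 / (k : ℝ)) * c⁻¹)) atTop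
      (𝓝 (ENNReal.ofReal c⁻¹)) := by
    refine ENNReal.tendsto_ofReal ?_
    have := ((Real.continuousAt_const_rpow hM.ne').tendsto.comp
      tendsto_one_div_atTop_nhds_zero_nat).mul_const c⁻¹
    simpa using this
  rw [← hlim.limsup_eq]
  refine limsup_le_limsup ?_
  filter_upwards [eventually_ge_atTop 1] with k hk
  have hk' : k ≠ 0 := by omega
  rw [← ENNReal.ofReal_natCast, ENNReal.ofReal_rpow_of_nonneg (by positivity) (by positivity)]
  refine ENNReal.ofReal_le_ofReal ?_
  calc (Nat.card (T.Desc k T.root) : ℝ) ^ (1 / (k : ℝ))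
      ≤ (M * c⁻¹ ^ k) ^ (1 / (k : ℝ)) := by
        refine Real.rpow_le_rpow (by positivity) ?_ (by positivity)
        rw [inv_pow, ← div_eq_mul_inv]
        exact (le_div_iff₀ (by positivity)).2 (h k)
    _ = M ^ (1 / (k : ℝ)) * c⁻¹ := by
        rw [Real.mul_rpow hM.le (by positivity), one_div,
          Real.pow_rpow_inv_natCast (by positivity) hk']

end ParentTree

/-- **Theorem (necessary condition: failure of `Δ_k = O(√|V_k|)`).** If `T` is an
infinite, locally finite rooted tree, `b ∈ [0,1)` and `b² · bargr T > 1`, then it is not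
the case that `Δ_k = O(√|V_k|)`, where `Δ_k` is the `ℓ²` norm of the descendant
generating function of the depth-`k` truncation `T_k` and `V_k` is its vertex set. -/
theorem delta_not_big_O_of_bargr
    {V : Type} [Infinite V] (T : ParentTree V)
    [∀ k : ℕ, Fintype {v : V // T.depth v ≤ k}]
    (hlf : ∀ v : V, (T.children v).Finite)
    {b : ℝ} (hb0 : 0 ≤ b) (hb1 : b < 1)
    (hgr : 1 < ENNReal.ofReal (b ^ 2) * T.bargr) :
    ¬ ∃ C : ℝ, ∀ k : ℕ,
      (T.trunc k).Delta b ≤ C * Real.sqrt (Fintype.card {v : V // T.depth v ≤ k}) := by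
  rintro ⟨C, hC⟩
  rcases hb0.eq_or_lt with rfl | hb
  · simp at hgr
  have hbound (k : ℕ) : (Nat.card (T.Desc k T.root) : ℝ) * (b ^ 2) ^ k ≤ C ^ 2 + 1 := by
    set s : ℝ := (Fintype.card {v : V // T.depth v ≤ k} : ℝ)
    have hs : 0 < s := by
      have : Nonempty {v : V // T.depth v ≤ k} := ⟨(T.trunc k).root⟩
      exact Nat.cast_pos.2 Fintype.card_pos
    have hle : Real.sqrt s * b ^ k ≤ C := by
      refine le_of_mul_le_mul_right ?_ (Real.sqrt_pos.2 hs)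
      calc Real.sqrt s * b ^ k * Real.sqrt s = s * b ^ k := by
            rw [mul_right_comm, Real.mul_self_sqrt hs.le]
        _ ≤ C * Real.sqrt s := (T.card_mul_pow_le_Delta_trunc hb0 hb1.le k).trans (hC k)
    calc (Nat.card (T.Desc k T.root) : ℝ) * (b ^ 2) ^ k ≤ s * (b ^ 2) ^ k := by
          gcongr
          exact Nat.cast_le.2 (T.card_Desc_root_le k)
      _ = (Real.sqrt s * b ^ k) ^ 2 := by rw [mul_pow, Real.sq_sqrt hs.le, pow_right_comm]
      _ ≤ C ^ 2 := by gcongr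
      _ ≤ C ^ 2 + 1 := by linarith
  refine hgr.not_ge ?_
  calc ENNReal.ofReal (b ^ 2) * T.bargr
      ≤ ENNReal.ofReal (b ^ 2) * ENNReal.ofReal (b ^ 2)⁻¹ := by
        gcongr
        exact T.bargr_le_of_card_mul_pow_le (by positivity) (by positivity) hbound
    _ = 1 := by
        rw [← ENNReal.ofReal_mul (by positivity), mul_inv_cancel₀ (by positivity),
          ENNReal.ofReal_one]
end

section
/- If an infinite locally finite rooted tree T is subperiodic, then bargr T = maxgr T, i.e. limsup_{r→∞} |D_r(ρ)|^{1/r} = limsup_{r→∞} max_{v∈V} |D_r(v)|^{1/r}. -/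
open MeasureTheory ProbabilityTheory Filter Topology
open scoped ENNReal NNReal

namespace ParentTree

/-- `v` lies on the path from the root to `u` (i.e. `v` is an ancestor of `u`, allowing
`v = u`). -/
def Anc {V : Type*} (T : ParentTree V) (v u : V) : Prop :=
  ∃ n : ℕ, T.parent^[n] u = v

/-- A rooted tree is subperiodic if there is `R ≥ 0` such that for every vertex `v` there
is a vertex `w` with `d(ρ,w) ≤ R` and an injective rooted-tree embedding of the
descendant tree `T_v` into the descendant tree `T_w` (sending `v` to `w` and commuting
with the parent map away from `v`). -/
def IsSubperiodic {V : Type*} (T : ParentTree V) : Prop :=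
  ∃ R : ℕ, ∀ v : V, ∃ w : V, T.depth w ≤ R ∧
    ∃ φ : V → V, φ v = w ∧
      Set.InjOn φ {u | T.Anc v u} ∧
      (∀ u, T.Anc v u → T.Anc w (φ u)) ∧
      (∀ u, T.Anc v u → u ≠ v → φ (T.parent u) = T.parent (φ u))

end ParentTree

namespace ParentTree

variable {V : Type*} (T : ParentTree V)

lemma depth_eq_depth_parent_add_one {v : V} (hv : v ≠ T.root) :
    T.depth v = T.depth (T.parent v) + 1 := by
  apply le_antisymm
  · refine Nat.sInf_le ?_
    change T.parent^[T.depth (T.parent v) + 1] v = T.root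
    rw [Function.iterate_succ_apply]
    exact T.depth_spec _
  · have hspec := T.depth_spec v
    cases h : T.depth v with
    | zero =>
        rw [h] at hspec
        exact absurd hspec hv
    | succ m =>
        rw [h, Function.iterate_succ_apply] at hspec
        exact Nat.succ_le_succ (Nat.sInf_le hspec)

lemma parent_iterate_root (n : ℕ) : T.parent^[n] T.root = T.root :=
  Function.iterate_fixed T.parent_root n

lemma mem_desc_zero {v w : V} : w ∈ T.Desc 0 v ↔ w = v := by
  constructor
  · exact fun h => h.1
  · rintro rfl
    exact ⟨rfl, rfl⟩

lemma mem_desc_succ {r : ℕ} {v w : V} :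
    w ∈ T.Desc (r + 1) v ↔ w ≠ T.root ∧ T.parent w ∈ T.Desc r v := by
  constructor
  · rintro ⟨hp, hd⟩
    have hw : w ≠ T.root := by
      rintro rfl
      rw [T.depth_root] at hd
      omega
    have := T.depth_eq_depth_parent_add_one hw
    exact ⟨hw, by rwa [Function.iterate_succ_apply] at hp, by omega⟩
  · rintro ⟨hw, hp, hd⟩
    have := T.depth_eq_depth_parent_add_one hw
    exact ⟨by rwa [Function.iterate_succ_apply], by omega⟩

lemma desc_finite (hlf : ∀ v : V, (T.children v).Finite) (r : ℕ) (v : V) :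
    (T.Desc r v).Finite := by
  induction r with
  | zero => exact (Set.finite_singleton v).subset fun w hw => T.mem_desc_zero.1 hw
  | succ r ih =>
      refine (ih.biUnion fun u _ => hlf u).subset fun w hw => ?_
      obtain ⟨hw, hp⟩ := T.mem_desc_succ.1 hw
      exact Set.mem_biUnion hp ⟨hw, rfl⟩

lemma desc_subset_desc_root (r : ℕ) (v : V) :
    T.Desc r v ⊆ T.Desc (r + T.depth v) T.root := by
  rintro w ⟨hp, hd⟩
  refine ⟨?_, by rw [T.depth_root]; omega⟩
  rw [add_comm, Function.iterate_add_apply, hp, T.depth_spec]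

/-- An embedding of descendant trees preserves generations. -/
lemma mapsTo_desc_of_embedding {v w : V} {φ : V → V} (hφ : φ v = w)
    (hinj : Set.InjOn φ {u | T.Anc v u}) (hanc : ∀ u, T.Anc v u → T.Anc w (φ u))
    (hpar : ∀ u, T.Anc v u → u ≠ v → φ (T.parent u) = T.parent (φ u)) (r : ℕ) :
    Set.MapsTo φ (T.Desc r v) (T.Desc r w) := by
  induction r with
  | zero =>
      intro u hu
      rw [T.mem_desc_zero.1 hu, hφ]
      exact T.mem_desc_zero.2 rfl
  | succ r ih =>
      intro u hu
      have hvu : T.Anc v u := ⟨_, hu.1⟩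
      have huv : u ≠ v := by
        rintro rfl
        have := hu.2
        omega
      refine T.mem_desc_succ.2 ⟨fun hroot => huv (hinj hvu ⟨0, rfl⟩ ?_), ?_⟩
      · obtain ⟨n, hn⟩ := hanc u hvu
        rw [hroot, T.parent_iterate_root] at hn
        rw [hroot, hφ, hn]
      · rw [← hpar u hvu huv]
        exact ih (T.mem_desc_succ.1 hu).2

lemma exists_card_desc_le_card_desc_root (hlf : ∀ v : V, (T.children v).Finite)
    (hsub : T.IsSubperiodic) :
    ∃ R : ℕ, ∀ (v : V) (r : ℕ), ∃ j ≤ R,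
      Nat.card (T.Desc r v) ≤ Nat.card (T.Desc (r + j) T.root) := by
  obtain ⟨R, hR⟩ := hsub
  refine ⟨R, fun v r => ?_⟩
  obtain ⟨w, hw, φ, hφ, hinj, hanc, hpar⟩ := hR v
  refine ⟨T.depth w, hw, ?_⟩
  have hmaps := T.mapsTo_desc_of_embedding hφ hinj hanc hpar r
  simp only [Nat.card_coe_set_eq]
  exact Set.ncard_le_ncard_of_injOn φ
    (fun u hu => T.desc_subset_desc_root r w (hmaps hu))
    (hinj.mono fun _ hu => Exists.intro r hu.1) (T.desc_finite hlf _ _)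

lemma bargr_le_maxgr : T.bargr ≤ T.maxgr :=
  limsup_le_limsup <| Eventually.of_forall fun r =>
    le_iSup (fun v : V => (Nat.card (T.Desc r v) : ℝ≥0∞) ^ (1 / (r : ℝ))) T.root

end ParentTree

lemma ENNReal.tendsto_mul_rpow_div_atTop (c : ℝ≥0) {K : ℝ≥0} (hK : 1 ≤ K) (R : ℕ) :
    Tendsto (fun r : ℕ => (c : ℝ≥0∞) * (K : ℝ≥0∞) ^ ((R : ℝ) / r)) atTop (𝓝 c) := by
  have hpow : Tendsto (fun r : ℕ => K ^ ((R : ℝ) / r)) atTop (𝓝 (K ^ (0 : ℝ))) :=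
    tendsto_const_nhds.nnrpow (tendsto_const_div_atTop_nhds_zero_nat (R : ℝ))
      (Or.inl (zero_lt_one.trans_le hK).ne')
  have hmul := ENNReal.tendsto_coe.2 (hpow.const_mul c)
  rw [NNReal.rpow_zero, mul_one] at hmul
  refine hmul.congr fun r => ?_
  rw [ENNReal.coe_mul, ENNReal.coe_rpow_of_nonneg K (by positivity)]

/-- **Proposition.** If an infinite locally finite rooted tree is subperiodic, then its
upper growth rate equals its maximum local growth rate. -/
theorem bargr_eq_maxgr_of_subperiodic
    {V : Type} [Infinite V] (T : ParentTree V)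
    (hlf : ∀ v : V, (T.children v).Finite)
    (hsub : T.IsSubperiodic) :
    T.bargr = T.maxgr := by
  obtain ⟨R, hR⟩ := T.exists_card_desc_le_card_desc_root hlf hsub
  refine le_antisymm T.bargr_le_maxgr (le_of_forall_gt_imp_ge_of_dense fun c hc => ?_)
  induction c with
  | top => exact le_top
  | coe c =>
  obtain ⟨N, hN⟩ := eventually_atTop.1 (eventually_lt_of_limsup_lt hc)
  rw [← (ENNReal.tendsto_mul_rpow_div_atTop c (le_max_right c 1) R).limsup_eq]
  refine limsup_le_limsup ?_
  filter_upwards [eventually_ge_atTop N, eventually_gt_atTop 0] with r hrN hr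
  refine iSup_le fun v => ?_
  obtain ⟨j, hj, hcard⟩ := hR v r
  have hr' : (0 : ℝ) < r := by exact_mod_cast hr
  have hroot : (Nat.card (T.Desc (r + j) T.root) : ℝ≥0∞) ≤ (c : ℝ≥0∞) ^ ((r + j : ℕ) : ℝ) := by
    have h := (hN (r + j) (by omega)).le
    rw [one_div] at h
    exact (ENNReal.rpow_inv_le_iff (by positivity)).1 h
  have hpos : (0 : ℝ) ≤ 1 / r := by positivity
  calc (Nat.card (T.Desc r v) : ℝ≥0∞) ^ (1 / (r : ℝ))
      ≤ ((c : ℝ≥0∞) ^ ((r + j : ℕ) : ℝ)) ^ (1 / (r : ℝ)) :=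
        ENNReal.rpow_le_rpow ((Nat.cast_le.2 hcard).trans hroot) hpos
    _ = (c : ℝ≥0∞) * (c : ℝ≥0∞) ^ ((j : ℝ) / r) := by
        rw [← ENNReal.rpow_mul, show ((r + j : ℕ) : ℝ) * (1 / (r : ℝ)) = 1 + (j : ℝ) / r by
          push_cast; field_simp, ENNReal.rpow_add_of_nonneg _ _ zero_le_one (by positivity),
          ENNReal.rpow_one]
    _ ≤ (c : ℝ≥0∞) * ((max c 1 : ℝ≥0) : ℝ≥0∞) ^ ((R : ℝ) / r) := by
        gcongr
        calc (c : ℝ≥0∞) ^ ((j : ℝ) / r)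
            ≤ ((max c 1 : ℝ≥0) : ℝ≥0∞) ^ ((j : ℝ) / r) :=
              ENNReal.rpow_le_rpow (ENNReal.coe_le_coe.2 (le_max_left c 1)) (by positivity)
          _ ≤ _ := ENNReal.rpow_le_rpow_of_exponent_le
              (by exact_mod_cast le_max_right c 1) (by gcongr)
end

section
/- Let 𝓗 be a Polish metric space of diameter at most 1, I a finite index set, and for each i ∈ I let μ_i, ν_i be Borel probability measures on 𝓗. For any positive weight function ω : I → ℝ^{>0}, the transportation metric associated with the weighted Hamming metric d_ω satisfies d̄_ω(⊗_{i∈I} μ_i, ⊗_{i∈I} ν_i) = (1/|I|) ∑_{i∈I} ω(i) · d̄(μ_i, ν_i), where d̄ is the transportation metric on Prob(𝓗) for the metric of 𝓗. -/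
open MeasureTheory ProbabilityTheory Filter Topology
open scoped ENNReal NNReal

section TransportCost

variable {X : Type*} [MeasurableSpace X] {c : X → X → ℝ} {μ ν : Measure X}

lemma transportCost_le_integral (hc : ∀ x y, 0 ≤ c x y) (γ : Measure (X × X))
    (hfst : γ.map Prod.fst = μ) (hsnd : γ.map Prod.snd = ν) :
    transportCost c μ ν ≤ ∫ q, c q.1 q.2 ∂γ :=
  csInf_le ⟨0, by rintro _ ⟨_, -, -, rfl⟩; exact integral_nonneg fun q => hc q.1 q.2⟩
    ⟨γ, hfst, hsnd, rfl⟩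

lemma nonempty_coupling_integrals (c : X → X → ℝ) (μ ν : Measure X)
    [IsProbabilityMeasure μ] [IsProbabilityMeasure ν] :
    {r : ℝ | ∃ γ : Measure (X × X),
      γ.map Prod.fst = μ ∧ γ.map Prod.snd = ν ∧ r = ∫ q, c q.1 q.2 ∂γ}.Nonempty :=
  ⟨_, μ.prod ν, by simp, by simp, rfl⟩

lemma le_transportCost [IsProbabilityMeasure μ] [IsProbabilityMeasure ν] {b : ℝ}
    (h : ∀ γ : Measure (X × X), γ.map Prod.fst = μ → γ.map Prod.snd = ν →
      b ≤ ∫ q, c q.1 q.2 ∂γ) :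
    b ≤ transportCost c μ ν :=
  le_csInf (nonempty_coupling_integrals c μ ν) <| by
    rintro _ ⟨γ, hfst, hsnd, rfl⟩
    exact h γ hfst hsnd

lemma exists_coupling_integral_lt_transportCost_add (c : X → X → ℝ) (μ ν : Measure X)
    [IsProbabilityMeasure μ] [IsProbabilityMeasure ν] {δ : ℝ} (hδ : 0 < δ) :
    ∃ γ : Measure (X × X), γ.map Prod.fst = μ ∧ γ.map Prod.snd = ν ∧
      ∫ q, c q.1 q.2 ∂γ < transportCost c μ ν + δ := by
  obtain ⟨_, ⟨γ, hfst, hsnd, rfl⟩, hlt⟩ :=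
    exists_lt_of_csInf_lt (nonempty_coupling_integrals c μ ν)
      (show transportCost c μ ν < transportCost c μ ν + δ by linarith)
  exact ⟨γ, hfst, hsnd, hlt⟩

end TransportCost

lemma isProbabilityMeasure_of_map_fst {X Y : Type*} [MeasurableSpace X] [MeasurableSpace Y]
    {μ : Measure X} [IsProbabilityMeasure μ] {γ : Measure (X × Y)}
    (h : γ.map Prod.fst = μ) : IsProbabilityMeasure γ := by
  subst h
  exact Measure.isProbabilityMeasure_of_map Prod.fst

lemma integrable_dist_of_diam_le_one {H : Type*} [PseudoMetricSpace H]
    [SecondCountableTopology H] [MeasurableSpace H] [OpensMeasurableSpace H]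
    (hdiam : Metric.ediam (Set.univ : Set H) ≤ 1) {Ω : Type*} [MeasurableSpace Ω]
    {γ : Measure Ω} [IsFiniteMeasure γ] {f g : Ω → H} (hf : Measurable f) (hg : Measurable g) :
    Integrable (fun q => dist (f q) (g q)) γ := by
  refine Integrable.of_bound (hf.dist hg).aestronglyMeasurable 1 (.of_forall fun q => ?_)
  rw [Real.norm_of_nonneg dist_nonneg, ← edist_le_ofReal zero_le_one, ENNReal.ofReal_one]
  exact (Metric.edist_le_ediam_of_mem (Set.mem_univ _) (Set.mem_univ _)).trans hdiam

lemma integral_weighted_hamming {H : Type*} [PseudoMetricSpace H]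
    [SecondCountableTopology H] [MeasurableSpace H] [OpensMeasurableSpace H]
    (hdiam : Metric.ediam (Set.univ : Set H) ≤ 1) {I : Type*} [Fintype I] (ω : I → ℝ)
    (γ : Measure ((I → H) × (I → H))) [IsFiniteMeasure γ] :
    ∫ q, (Fintype.card I : ℝ)⁻¹ * ∑ i, ω i * dist (q.1 i) (q.2 i) ∂γ =
      (Fintype.card I : ℝ)⁻¹ * ∑ i, ω i *
        ∫ p, dist p.1 p.2 ∂γ.map (fun q => (q.1 i, q.2 i)) := by
  rw [integral_const_mul, integral_finsetSum]
  · congr 1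
    refine Finset.sum_congr rfl fun i _ => ?_
    rw [integral_const_mul, integral_map (by fun_prop)
      (measurable_fst.dist measurable_snd).aestronglyMeasurable]
  · intro i _
    exact (integrable_dist_of_diam_le_one hdiam (by fun_prop) (by fun_prop)).const_mul _

/-- **Lemma (transportation metric of product measures for weighted Hamming metrics).**
For Borel probability measures `μ_i, ν_i` on a Polish metric space `H` of diameter at
most `1` and a positive weight function `ω` on a finite index set `I`,
`d̄_ω(⊗μ_i, ⊗ν_i) = (1/|I|)·∑_i ω(i)·d̄(μ_i,ν_i)`. -/
theorem transport_weighted_hamming_product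
    {H : Type} [MetricSpace H] [TopologicalSpace.SeparableSpace H] [CompleteSpace H]
    [MeasurableSpace H] [BorelSpace H]
    (hdiam : EMetric.diam (Set.univ : Set H) ≤ 1)
    {I : Type} [Fintype I]
    (μ ν : I → MeasureTheory.Measure H)
    (hμ : ∀ i, MeasureTheory.IsProbabilityMeasure (μ i))
    (hν : ∀ i, MeasureTheory.IsProbabilityMeasure (ν i))
    (ω : I → ℝ) (hω : ∀ i, 0 < ω i) :
    transportCost
        (fun x y : I → H => (Fintype.card I : ℝ)⁻¹ * ∑ i, ω i * dist (x i) (y i))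
        (MeasureTheory.Measure.pi μ) (MeasureTheory.Measure.pi ν) =
      (Fintype.card I : ℝ)⁻¹ * ∑ i, ω i * transportCost dist (μ i) (ν i) := by
  have : SecondCountableTopology H := UniformSpace.secondCountable_of_separable H
  set N : ℝ := (Fintype.card I : ℝ)⁻¹ with hN
  have hN0 : 0 ≤ N := by positivity
  apply le_antisymm
  · refine le_of_forall_pos_le_add fun ε hε => ?_
    have hS : 0 ≤ N * ∑ i, ω i := mul_nonneg hN0 (Finset.sum_nonneg fun i _ => (hω i).le)
    set δ : ℝ := ε / (N * ∑ i, ω i + 1) with hδ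
    have hδ0 : 0 < δ := by positivity
    choose γ hfst hsnd hlt using fun i =>
      exists_coupling_integral_lt_transportCost_add dist (μ i) (ν i) hδ0
    have (i : I) : IsProbabilityMeasure (γ i) := isProbabilityMeasure_of_map_fst (hfst i)
    let e : (I → H × H) → (I → H) × (I → H) := fun q => (fun i => (q i).1, fun i => (q i).2)
    have he : Measurable e := by fun_prop
    have : IsProbabilityMeasure ((Measure.pi γ).map e) :=
      Measure.isProbabilityMeasure_map he.aemeasurable
    have hmarginal (i : I) :
        ((Measure.pi γ).map e).map (fun q => (q.1 i, q.2 i)) = γ i := by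
      rw [Measure.map_map (by fun_prop) he]
      exact (measurePreserving_eval γ i).map_eq
    have hfst_e : ((Measure.pi γ).map e).map Prod.fst = Measure.pi μ := by
      have (i : I) : SigmaFinite ((γ i).map Prod.fst) := by rw [hfst]; infer_instance
      rw [Measure.map_map measurable_fst he, ← funext hfst]
      exact Measure.pi_map_pi fun i => measurable_fst.aemeasurable
    have hsnd_e : ((Measure.pi γ).map e).map Prod.snd = Measure.pi ν := by
      have (i : I) : SigmaFinite ((γ i).map Prod.snd) := by rw [hsnd]; infer_instance
      rw [Measure.map_map measurable_snd he, ← funext hsnd]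
      exact Measure.pi_map_pi fun i => measurable_snd.aemeasurable
    calc
      _ ≤ _ := transportCost_le_integral
        (fun x y => mul_nonneg hN0 <|
          Finset.sum_nonneg fun i _ => mul_nonneg (hω i).le dist_nonneg) _ hfst_e hsnd_e
      _ = N * ∑ i, ω i * ∫ p, dist p.1 p.2 ∂γ i := by
        simp_rw [hN, integral_weighted_hamming hdiam ω, hmarginal]
      _ ≤ N * ∑ i, ω i * (transportCost dist (μ i) (ν i) + δ) := by
        gcongr with i
        · exact (hω i).le
        · exact (hlt i).le
      _ = N * ∑ i, ω i * transportCost dist (μ i) (ν i) + (N * ∑ i, ω i) * δ := by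
        simp_rw [mul_add, Finset.sum_add_distrib, ← Finset.sum_mul]
        ring
      _ ≤ N * ∑ i, ω i * transportCost dist (μ i) (ν i) + ε := by
        gcongr
        rw [hδ, mul_div_assoc', div_le_iff₀ (by positivity)]
        nlinarith
  · refine le_transportCost fun γ hfst hsnd => ?_
    have := isProbabilityMeasure_of_map_fst hfst
    rw [integral_weighted_hamming hdiam ω]
    gcongr with i
    · exact (hω i).le
    refine transportCost_le_integral (fun _ _ => dist_nonneg) _ ?_ ?_
    · rw [Measure.map_map measurable_fst (by fun_prop), ← (measurePreserving_eval μ i).map_eq,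
        ← hfst, Measure.map_map (by fun_prop) measurable_fst]
      rfl
    · rw [Measure.map_map measurable_snd (by fun_prop), ← (measurePreserving_eval ν i).map_eq,
        ← hsnd, Measure.map_map (by fun_prop) measurable_snd]
      rfl
end

section
/- Let 𝓗 be a Polish metric space of diameter at most 1, n ∈ ℕ, ω : {1,…,n} → ℝ^{>0} a weight function, and p a Borel probability measure on 𝓗 with product measure p^n on 𝓗^n. Then for every f : 𝓗^n → ℝ that is 1-Lipschitz with respect to the weighted Hamming metric d_ω and satisfies ∫ f dp^n = 0, and every λ ∈ ℝ, one has ∫ e^{nλf} dp^n ≤ e^{λ² ∑_{i=1}^n ω(i)² / 8}. -/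
open MeasureTheory ProbabilityTheory Filter Topology
open scoped ENNReal NNReal

/-- A function on a finite power of a metric space which is Lipschitz for a weighted
`ℓ¹` distance is continuous. -/
lemma continuous_of_abs_sub_le_sum_mul_dist {ι H : Type*} [Fintype ι] [PseudoMetricSpace H]
    {c : ι → ℝ} {g : (ι → H) → ℝ}
    (hg : ∀ x y, |g x - g y| ≤ ∑ i, c i * dist (x i) (y i)) : Continuous g := by
  refine continuous_iff_continuousAt.2 fun y => tendsto_iff_dist_tendsto_zero.2 ?_
  refine squeeze_zero (fun _ => dist_nonneg) (fun x => hg x y) ?_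
  have h : Continuous fun x : ι → H => ∑ i, c i * dist (x i) (y i) := by fun_prop
  simpa using h.tendsto y

/-- A function on a finite power of a separable metric space of diameter at most `1` which is
Lipschitz for a weighted `ℓ¹` distance is integrable for every finite measure. -/
lemma integrable_of_abs_sub_le_sum_mul_dist {ι H : Type*} [Fintype ι] [PseudoMetricSpace H]
    [SecondCountableTopology H] [MeasurableSpace H] [BorelSpace H]
    (hd : ∀ x y : H, dist x y ≤ 1) {c : ι → ℝ} (hc : ∀ i, 0 ≤ c i) {g : (ι → H) → ℝ}
    (hg : ∀ x y, |g x - g y| ≤ ∑ i, c i * dist (x i) (y i))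
    (μ : Measure (ι → H)) [IsFiniteMeasure μ] :
    Integrable g μ ∧ Integrable (fun x => Real.exp (g x)) μ := by
  have hcont := continuous_of_abs_sub_le_sum_mul_dist hg
  rcases isEmpty_or_nonempty (ι → H) with hE | ⟨⟨y⟩⟩
  · simp [Measure.eq_zero_of_isEmpty μ]
  have hb : ∀ x, |g x| ≤ |g y| + ∑ i, c i := fun x => by
    have h1 : |g x - g y| ≤ ∑ i, c i :=
      (hg x y).trans (Finset.sum_le_sum fun i _ => mul_le_of_le_one_right (hc i) (hd _ _))
    have h2 := abs_sub_abs_le_abs_sub (g x) (g y)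
    linarith
  refine ⟨Integrable.of_bound hcont.aestronglyMeasurable _ (ae_of_all _ hb),
    Integrable.of_bound (Real.continuous_exp.comp hcont).aestronglyMeasurable
      (Real.exp (|g y| + ∑ i, c i)) (ae_of_all _ fun x => ?_)⟩
  rw [Real.norm_eq_abs, Real.abs_exp]
  exact Real.exp_le_exp.2 ((le_abs_self _).trans (hb x))

/-- **Hoeffding's lemma** for a random variable of oscillation at most `c`. -/
lemma integral_exp_le_of_abs_sub_le {Ω : Type*} [MeasurableSpace Ω] {μ : Measure Ω}
    [IsProbabilityMeasure μ] {X : Ω → ℝ} (hX : AEMeasurable X μ) {c : ℝ}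
    (hosc : ∀ x y, |X x - X y| ≤ c) :
    ∫ x, Real.exp (X x) ∂μ ≤ Real.exp (∫ x, X x ∂μ + c ^ 2 / 8) := by
  obtain ⟨y⟩ : Nonempty Ω := nonempty_of_isProbabilityMeasure μ
  have hbdd : BddBelow (Set.range X) := by
    refine ⟨X y - c, ?_⟩
    rintro _ ⟨x, rfl⟩
    linarith [(abs_le.1 (hosc x y)).1]
  have hmem : ∀ x, X x ∈ Set.Icc (⨅ z, X z) ((⨅ z, X z) + c) := fun x => by
    have : Nonempty Ω := ⟨y⟩
    refine ⟨ciInf_le hbdd x, ?_⟩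
    have : X x - c ≤ ⨅ z, X z := le_ciInf fun z => by linarith [(abs_le.1 (hosc x z)).2]
    linarith
  have h := (hasSubgaussianMGF_of_mem_Icc hX (ae_of_all _ hmem)).mgf_le 1
  have hcoe : (((‖(⨅ z, X z) + c - ⨅ z, X z‖₊ / 2) ^ 2 : ℝ≥0) : ℝ) * 1 ^ 2 / 2 = c ^ 2 / 8 := by
    push_cast
    rw [add_sub_cancel_left, Real.norm_eq_abs, div_pow, sq_abs]
    ring
  rw [hcoe] at h
  simp only [mgf, one_mul, Real.exp_sub, integral_div] at h
  rwa [div_le_iff₀ (Real.exp_pos _), ← Real.exp_add, add_comm] at h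

/-- Exponential moment form of **McDiarmid's inequality** for a function on a finite power of a
separable metric space of diameter at most `1` which is Lipschitz for a weighted `ℓ¹` distance. -/
lemma integral_exp_pi_le_of_abs_sub_le_sum_mul_dist {H : Type*} [PseudoMetricSpace H]
    [SecondCountableTopology H] [MeasurableSpace H] [BorelSpace H]
    (hd : ∀ x y : H, dist x y ≤ 1) (p : Measure H) [IsProbabilityMeasure p] {n : ℕ}
    {c : Fin n → ℝ} (hc : ∀ i, 0 ≤ c i) {g : (Fin n → H) → ℝ}
    (hg : ∀ x y, |g x - g y| ≤ ∑ i, c i * dist (x i) (y i)) :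
    ∫ x, Real.exp (g x) ∂(Measure.pi fun _ => p) ≤
      Real.exp (∫ x, g x ∂(Measure.pi fun _ => p) + (∑ i, c i ^ 2) / 8) := by
  induction n with
  | zero =>
    have hconst : g = fun _ => g Fin.elim0 :=
      funext fun x => congrArg g (Subsingleton.elim x _)
    rw [hconst]
    simp
  | succ n ih =>
    obtain ⟨hint, hexp⟩ := integrable_of_abs_sub_le_sum_mul_dist hd hc hg (Measure.pi fun _ => p)
    have hcont := continuous_of_abs_sub_le_sum_mul_dist hg
    have hmp := (measurePreserving_piFinSuccAbove (fun _ : Fin (n + 1) => p) 0).symm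
    have hcons : ∀ z : H × (Fin n → H), (MeasurableEquiv.piFinSuccAbove (fun _ => H) 0).symm z =
        (Fin.cons z.1 z.2 : Fin (n + 1) → H) := fun z => by
      simp [MeasurableEquiv.piFinSuccAbove_symm_apply, Fin.insertNthEquiv]
    have hfub : ∀ F : (Fin (n + 1) → H) → ℝ, Integrable F (Measure.pi fun _ => p) →
        Integrable (fun y => ∫ h, F (Fin.cons h y) ∂p) (Measure.pi fun _ : Fin n => p) ∧
        ∫ x, F x ∂(Measure.pi fun _ => p) =
          ∫ y, ∫ h, F (Fin.cons h y) ∂p ∂(Measure.pi fun _ : Fin n => p) := fun F hF => by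
      have hF' := hmp.integrable_comp_of_integrable hF
      simp only [Function.comp_def, hcons] at hF'
      refine ⟨hF'.integral_prod_right, ?_⟩
      rw [← hmp.integral_comp']
      simp only [hcons]
      exact integral_prod_symm _ hF'
    have hsec : ∀ y : Fin n → H, Continuous fun h => g (Fin.cons h y) := fun y =>
      hcont.comp (Continuous.finCons (A := fun _ => H) continuous_id continuous_const)
    have hosc : ∀ (y : Fin n → H) (h h' : H), |g (Fin.cons h y) - g (Fin.cons h' y)| ≤ c 0 :=
      fun y h h' => (hg _ _).trans <| by
        simpa [Fin.sum_univ_succ] using mul_le_of_le_one_right (hc 0) (hd h h')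
    have hsec_int : ∀ y : Fin n → H, Integrable (fun h => g (Fin.cons h y)) p := fun y => by
      obtain ⟨h₀⟩ : Nonempty H := nonempty_of_isProbabilityMeasure p
      refine Integrable.of_bound (hsec y).aestronglyMeasurable (|g (Fin.cons h₀ y)| + c 0)
        (ae_of_all _ fun h => ?_)
      have := abs_sub_abs_le_abs_sub (g (Fin.cons h y)) (g (Fin.cons h₀ y))
      rw [Real.norm_eq_abs]
      linarith [hosc y h h₀]
    set G : (Fin n → H) → ℝ := fun y => ∫ h, g (Fin.cons h y) ∂p with hG
    have hGlip : ∀ x y, |G x - G y| ≤ ∑ i : Fin n, c i.succ * dist (x i) (y i) := fun x y => by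
      rw [hG, ← integral_sub (hsec_int x) (hsec_int y), ← Real.norm_eq_abs]
      refine (norm_integral_le_of_norm_le_const (ae_of_all _ fun h => ?_)).trans_eq
        (by rw [probReal_univ, mul_one])
      simpa [Fin.sum_univ_succ] using hg (Fin.cons h x) (Fin.cons h y)
    have hGexp := (integrable_of_abs_sub_le_sum_mul_dist hd (fun i : Fin n => hc i.succ) hGlip
      (Measure.pi fun _ => p)).2
    calc ∫ x, Real.exp (g x) ∂(Measure.pi fun _ => p)
        = ∫ y, ∫ h, Real.exp (g (Fin.cons h y)) ∂p ∂(Measure.pi fun _ : Fin n => p) :=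
          (hfub _ hexp).2
      _ ≤ ∫ y, Real.exp (G y) * Real.exp (c 0 ^ 2 / 8) ∂(Measure.pi fun _ : Fin n => p) := by
          refine integral_mono (hfub _ hexp).1 (hGexp.mul_const _) fun y => ?_
          rw [← Real.exp_add]
          exact integral_exp_le_of_abs_sub_le (hsec y).measurable.aemeasurable (hosc y)
      _ = (∫ y, Real.exp (G y) ∂(Measure.pi fun _ : Fin n => p)) * Real.exp (c 0 ^ 2 / 8) :=
          integral_mul_const _ _
      _ ≤ Real.exp (∫ y, G y ∂(Measure.pi fun _ : Fin n => p) + (∑ i : Fin n, c i.succ ^ 2) / 8) *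
            Real.exp (c 0 ^ 2 / 8) := by
          gcongr
          exact ih (fun i => hc i.succ) hGlip
      _ = Real.exp (∫ x, g x ∂(Measure.pi fun _ => p) + (∑ i, c i ^ 2) / 8) := by
          rw [← Real.exp_add, (hfub g hint).2, Fin.sum_univ_succ]
          congr 1
          ring

/-- **Proposition (McDiarmid's inequality for weighted Hamming metrics).** For a Borel
probability measure `p` on a Polish metric space `H` of diameter at most `1`, a weight
function `ω` on `{1,…,n}`, and `f : H^n → ℝ` 1-Lipschitz for the weighted Hamming metric
`d_ω` with `∫ f dpⁿ = 0`, one has `∫ e^{nλf} dpⁿ ≤ exp(λ²·∑ᵢ ω(i)²/8)` for every `λ`. -/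
theorem weighted_mcdiarmid
    {H : Type} [MetricSpace H] [TopologicalSpace.SeparableSpace H] [CompleteSpace H]
    [MeasurableSpace H] [BorelSpace H]
    (hdiam : EMetric.diam (Set.univ : Set H) ≤ 1)
    (n : ℕ) (ω : Fin n → ℝ) (hω : ∀ i, 0 < ω i)
    (p : MeasureTheory.Measure H) (hp : MeasureTheory.IsProbabilityMeasure p)
    (f : (Fin n → H) → ℝ)
    (hf : ∀ x y : Fin n → H,
      |f x - f y| ≤ (n : ℝ)⁻¹ * ∑ i, ω i * dist (x i) (y i))
    (hf0 : (∫ x, f x ∂(MeasureTheory.Measure.pi fun _ : Fin n => p)) = 0)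
    (lam : ℝ) :
    ∫ x, Real.exp ((n : ℝ) * lam * f x) ∂(MeasureTheory.Measure.pi fun _ : Fin n => p) ≤
      Real.exp (lam ^ 2 * (∑ i, ω i ^ 2) / 8) := by
  have hd : ∀ x y : H, dist x y ≤ 1 := fun x y => by
    have h := (Metric.edist_le_ediam_of_mem (Set.mem_univ x) (Set.mem_univ y)).trans hdiam
    rw [edist_dist] at h
    simpa using h
  have hg : ∀ x y : Fin n → H, |(n : ℝ) * lam * f x - n * lam * f y| ≤
      ∑ i, |lam| * ω i * dist (x i) (y i) := fun x y => by
    have hS : 0 ≤ ∑ i, |lam| * ω i * dist (x i) (y i) := Finset.sum_nonneg fun i _ =>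
      mul_nonneg (mul_nonneg (abs_nonneg _) (hω i).le) dist_nonneg
    calc |(n : ℝ) * lam * f x - n * lam * f y| = n * |lam| * |f x - f y| := by
          rw [← mul_sub, abs_mul, abs_mul, Nat.abs_cast]
      _ ≤ n * |lam| * ((n : ℝ)⁻¹ * ∑ i, ω i * dist (x i) (y i)) := by gcongr; exact hf x y
      _ = (n * (n : ℝ)⁻¹) * ∑ i, |lam| * ω i * dist (x i) (y i) := by
          simp only [mul_assoc, ← Finset.mul_sum]
          ring
      _ ≤ ∑ i, |lam| * ω i * dist (x i) (y i) :=
          mul_le_of_le_one_left hS mul_inv_le_one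
  have : SecondCountableTopology H := UniformSpace.secondCountable_of_separable H
  refine (integral_exp_pi_le_of_abs_sub_le_sum_mul_dist hd p
    (fun i => mul_nonneg (abs_nonneg lam) (hω i).le) hg).trans_eq ?_
  simp only [integral_const_mul, hf0, mul_zero, zero_add, mul_pow, sq_abs, Finset.mul_sum]
end
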